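/- (Theorem 1.6, main result, in N variables.) Let λ^1,…,λ^r be partitions and N ≥ 1. Then, in ℤ[q,t,x_1,…,x_N], Σ_{π ∈ 𝒫([r])} (−1)^{#π−1}(#π−1)! Π_{B∈π} H̃_{λ^B}^{(N)} = (q−1)^{r−1} · Σ_{σ : λ^{[r]} → {1,…,N}} 𝓘_{G^σ}(q) · t^{maj(σ)} · x^σ, where the sum on the right runs over all fillings σ of λ^{[r]} with entries in {1,…,N}. -/

import Mathlib

open Finset

open scoped Classical

noncomputable section

/-! ### Set partitions -/

/-- `π` is a set partition of the finite set `H`. -/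
def IsSetPartition {α : Type*} (π : Finset (Finset α)) (H : Finset α) : Prop :=
  (∀ B ∈ π, B ⊆ H) ∧ (∀ B ∈ π, B.Nonempty) ∧
    (∀ B ∈ π, ∀ C ∈ π, B ≠ C → Disjoint B C) ∧ (∀ a ∈ H, ∃ B ∈ π, a ∈ B)

/-- The finite set of all set partitions of `H`. -/
def setPartitions {α : Type*} (H : Finset α) : Finset (Finset (Finset α)) :=
  H.powerset.powerset.filter (fun π => IsSetPartition π H)

/-- The joint cumulant of the family `u` on the subset `H`. -/
def jointCumulant {A : Type*} [CommRing A] {ι : Type*} (u : Finset ι → A) (H : Finset ι) : A :=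
  ∑ π ∈ setPartitions H,
    (-1 : A) ^ (π.card - 1) * ((π.card - 1).factorial : A) * ∏ B ∈ π, u B

/-! ### Multigraphs -/

/-- Number of edges of the multigraph with endpoint map `ends` whose endpoint set is `{i,j}`. -/
def eCnt {V E : Type*} [Fintype E] (ends : E → Sym2 V) (i j : V) : ℕ :=
  (univ.filter fun e => ends e = s(i, j)).card

/-- The spanning subgraph `(V, S)` is connected. -/
def SConnected {V E : Type*} (ends : E → Sym2 V) (S : Finset E) : Prop :=
  ∀ v w : V, Relation.ReflTransGen (fun a b => ∃ e ∈ S, ends e = s(a, b)) v w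

/-- The subgraph `(B, S)` is connected. -/
def SConnectedOn {V E : Type*} (ends : E → Sym2 V) (B : Finset V) (S : Finset E) : Prop :=
  ∀ v ∈ B, ∀ w ∈ B, Relation.ReflTransGen (fun a b => ∃ e ∈ S, ends e = s(a, b)) v w

/-- `E|_B`: the edges with both endpoints in `B`. -/
def edgesIn {V E : Type*} [Fintype E] (ends : E → Sym2 V) (B : Finset V) : Finset E :=
  univ.filter fun e => ∀ v ∈ ends e, v ∈ B

/-- `c_{G|_B}(q) = Σ_{S ⊆ E|_B, (B,S) connected} q^{#S}` as a polynomial in `q`. -/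
def connPoly {V E : Type*} [Fintype E] (ends : E → Sym2 V) (B : Finset V) : Polynomial ℤ :=
  ∑ S ∈ (edgesIn ends B).powerset.filter (fun S => SConnectedOn ends B S),
    Polynomial.X ^ S.card

/-- Number of edges joining `w` to some vertex of `B`. -/
def dCnt {V E : Type*} [Fintype E] (ends : E → Sym2 V) (B : Finset V) (w : V) : ℕ :=
  (univ.filter fun e => ∃ b ∈ B, ends e = s(w, b)).card

/-! ### The `G`-inversion polynomial -/

/-- `[m]_q = 1 + q + ⋯ + q^{m-1}`. -/
def nq {R : Type*} [CommSemiring R] (q : R) (m : ℕ) : R := ∑ k ∈ Finset.range m, q ^ k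

/-- Rooted spanning trees (encoded by parent maps, rooted at `0`) of the simple graph `G̃`
underlying the multigraph on `Fin (r+1)` with edge multiplicities `e`. -/
def parentMaps {r : ℕ} (e : Fin (r+1) → Fin (r+1) → ℕ) : Finset (Fin (r+1) → Fin (r+1)) :=
  univ.filter fun p => p 0 = 0 ∧ (∀ w, w ≠ 0 → p w ≠ w ∧ 0 < e w (p w)) ∧ ∀ w, ∃ k, p^[k] w = 0

/-- `(i,j)` is a `κ`-inversion of the spanning tree encoded by `p`. -/
def isKappaInv {r : ℕ} (e : Fin (r+1) → Fin (r+1) → ℕ) (p : Fin (r+1) → Fin (r+1))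
    (i j : Fin (r+1)) : Prop :=
  i ≠ 0 ∧ j ≠ 0 ∧ i ≠ j ∧ (∃ k, p^[k] j = i) ∧ j < i ∧ p i ≠ j ∧ 0 < e j (p i)

/-- `κ(T) = Σ_{(i,j) κ-inversion} e_{parent(i), j}`. -/
def kappaStat {r : ℕ} (e : Fin (r+1) → Fin (r+1) → ℕ) (p : Fin (r+1) → Fin (r+1)) : ℕ :=
  ∑ pr ∈ (univ ×ˢ univ : Finset (Fin (r+1) × Fin (r+1))).filter
    (fun pr => isKappaInv e p pr.1 pr.2), e (p pr.1) pr.2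

/-- `δ_T(w) = Σ_u e_{u, parent(w)}`, `u` ranging over descendants of `w` together with `w`. -/
def deltaStat {r : ℕ} (e : Fin (r+1) → Fin (r+1) → ℕ) (p : Fin (r+1) → Fin (r+1))
    (w : Fin (r+1)) : ℕ :=
  ∑ u ∈ univ.filter (fun u => ∃ k, p^[k] u = w), e u (p w)

/-- The `G`-inversion polynomial `𝓘_G(q)` of the multigraph on `Fin (r+1)` with
edge multiplicities `e`, evaluated at an element `q` of a commutative (semi)ring. -/
def Iinv {r : ℕ} {R : Type*} [CommSemiring R] (e : Fin (r+1) → Fin (r+1) → ℕ) (q : R) : R :=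
  q ^ (∑ i, e i i) *
    ∑ p ∈ parentMaps e, q ^ kappaStat e p * ∏ w ∈ univ.erase (0 : Fin (r+1)), nq q (e w (p w))

/-! ### Partitions, Young diagrams and fillings -/

/-- `f : ℕ → ℕ` encodes a partition: `f j` is the `j`-th part (for `j ≥ 1`). -/
def IsPartitionFun (f : ℕ → ℕ) : Prop := Antitone f ∧ ∃ N, f N = 0

/-- The number of (nonempty) rows of the diagram of `f`. -/
def nRows (f : ℕ → ℕ) : ℕ := sSup {j | f j ≠ 0}

/-- `λ^t_i`: the length of the `i`-th column of the diagram of `f`. -/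
def colLen (f : ℕ → ℕ) (i : ℕ) : ℕ :=
  ((Finset.Icc 1 (nRows f)).filter (fun j => i ≤ f j)).card

/-- The cells `(i,j)`, `1 ≤ i ≤ f j`, `j ≥ 1`, of the Young diagram of `f`
(French convention, `i` the column index and `j` the row index). -/
def cells (f : ℕ → ℕ) : Finset (ℕ × ℕ) :=
  (Finset.Icc 1 (f 1) ×ˢ Finset.Icc 1 (nRows f)).filter (fun c => c.1 ≤ f c.2)

/-- Fillings of the diagram of `f` with entries in `{1, …, N}`, encoded as functions
`ℕ × ℕ → ℕ` vanishing outside the diagram. -/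
def fillings (f : ℕ → ℕ) (N : ℕ) : Finset ((ℕ × ℕ) → ℕ) :=
  ((cells f).pi (fun _ => Finset.Icc 1 N)).image
    (fun g c => if h : c ∈ cells f then g c h else 0)

/-- The descent set of a filling. -/
def desSet (f : ℕ → ℕ) (σ : (ℕ × ℕ) → ℕ) : Finset (ℕ × ℕ) :=
  (cells f).filter (fun c => 2 ≤ c.2 ∧ σ (c.1, c.2 - 1) < σ c)

/-- `maj(σ) = Σ_{□ ∈ Des(σ)} (leg(□) + 1)`. -/
def majStat (f : ℕ → ℕ) (σ : (ℕ × ℕ) → ℕ) : ℕ :=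
  ∑ c ∈ desSet f σ, (colLen f c.1 - c.2 + 1)

/-- The counterclockwise-increasing condition defining inversion pairs; the box below `c1`
is read via `σ`, which vanishes off the diagram (giving the convention `σ(□_3) = 0`). -/
def invTriple (σ : (ℕ × ℕ) → ℕ) (c1 c2 : ℕ × ℕ) : Prop :=
  (σ c1 ≤ σ (c1.1, c1.2 - 1) ∧ σ (c1.1, c1.2 - 1) < σ c2) ∨
  (σ (c1.1, c1.2 - 1) < σ c2 ∧ σ c2 < σ c1) ∨
  (σ c2 < σ c1 ∧ σ c1 ≤ σ (c1.1, c1.2 - 1))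

/-- The set of inversion pairs of a filling. -/
def invPairs (f : ℕ → ℕ) (σ : (ℕ × ℕ) → ℕ) : Finset ((ℕ × ℕ) × (ℕ × ℕ)) :=
  ((cells f) ×ˢ (cells f)).filter
    (fun pr => pr.1.2 = pr.2.2 ∧ pr.1.1 < pr.2.1 ∧ invTriple σ pr.1 pr.2)

/-- `inv(σ)`: the number of inversion pairs. -/
def invStat (f : ℕ → ℕ) (σ : (ℕ × ℕ) → ℕ) : ℕ := (invPairs f σ).card

/-! ### The ring `ℤ[q, t, x₁, x₂, …]` and Macdonald polynomials -/

/-- The polynomial ring `ℤ[q, t, x₀, x₁, x₂, …]`. -/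
abbrev MR : Type := MvPolynomial (Fin 2 ⊕ ℕ) ℤ

/-- The variable `q`. -/
def qv : MR := MvPolynomial.X (Sum.inl 0)

/-- The variable `t`. -/
def tv : MR := MvPolynomial.X (Sum.inl 1)

/-- The variable `x_k`. -/
def xv (k : ℕ) : MR := MvPolynomial.X (Sum.inr k)

/-- Haglund's formula: the modified Macdonald polynomial in the variables `x_1, …, x_N`. -/
def macH (f : ℕ → ℕ) (N : ℕ) : MR :=
  ∑ σ ∈ fillings f N, qv ^ invStat f σ * tv ^ majStat f σ * ∏ c ∈ cells f, xv (σ c)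

/-- `λ^B = ⊕_{b ∈ B} λ^b`. -/
def lamB {r : ℕ} (lam : Fin (r+1) → ℕ → ℕ) (B : Finset (Fin (r+1))) : ℕ → ℕ :=
  fun j => ∑ b ∈ B, lam b j

/-- The (unnormalized) Macdonald cumulant
`Σ_{π ∈ 𝒫([r])} (-1)^{#π-1} (#π-1)! Π_{B ∈ π} H̃_{λ^B}`. -/
def macCumulant {r : ℕ} (lam : Fin (r+1) → ℕ → ℕ) (N : ℕ) : MR :=
  ∑ π ∈ setPartitions (univ : Finset (Fin (r+1))),
    (-1 : MR) ^ (π.card - 1) * ((π.card - 1).factorial : MR) * ∏ B ∈ π, macH (lamB lam B) N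

/-! ### Coloring of the diagram `λ^B` -/

/-- Labels `(b, i)`, `b ∈ B`, `1 ≤ i ≤ λ^b_1`, of the columns of the diagrams `λ^b`, `b ∈ B`. -/
def columnPairs {r : ℕ} (lam : Fin (r+1) → ℕ → ℕ) (B : Finset (Fin (r+1))) :
    Finset (Fin (r+1) × ℕ) :=
  (B ×ˢ Finset.Icc 1 (lamB lam B 1)).filter (fun p => p.2 ≤ lam p.1 1)

/-- The column `p'` comes weakly before the column `p` in the sorted order
(longer first; ties first by color, then by column index). -/
def colBefore {r : ℕ} (lam : Fin (r+1) → ℕ → ℕ) (p' p : Fin (r+1) × ℕ) : Prop :=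
  colLen (lam p.1) p.2 < colLen (lam p'.1) p'.2 ∨
    (colLen (lam p'.1) p'.2 = colLen (lam p.1) p.2 ∧
      (p'.1 < p.1 ∨ (p'.1 = p.1 ∧ p'.2 ≤ p.2)))

/-- The position in `λ^B` of the column `i` of `λ^b`. -/
def posIn {r : ℕ} (lam : Fin (r+1) → ℕ → ℕ) (B : Finset (Fin (r+1)))
    (b : Fin (r+1)) (i : ℕ) : ℕ :=
  ((columnPairs lam B).filter (fun p' => colBefore lam p' (b, i))).card

/-- The label `(b, i)` of the column of `λ^B` at position `c`. -/
def colAt {r : ℕ} (lam : Fin (r+1) → ℕ → ℕ) (B : Finset (Fin (r+1))) (c : ℕ) :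
    Fin (r+1) × ℕ :=
  if h : ∃ p ∈ columnPairs lam B, posIn lam B p.1 p.2 = c then h.choose else (0, 1)

/-- The filling `σ^B` of `λ^B` induced from a filling `σ` of `λ^{[r]}` via the
identification of boxes given by the coloring. -/
def inducedFilling {r : ℕ} (lam : Fin (r+1) → ℕ → ℕ) (B : Finset (Fin (r+1)))
    (σ : (ℕ × ℕ) → ℕ) : (ℕ × ℕ) → ℕ :=
  fun cj =>
    if ∃ p ∈ columnPairs lam B, posIn lam B p.1 p.2 = cj.1 then
      σ (posIn lam univ (colAt lam B cj.1).1 (colAt lam B cj.1).2, cj.2)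
    else 0

/-- The color of the column `x` of `λ^{[r]}`. -/
def colColor {r : ℕ} (lam : Fin (r+1) → ℕ → ℕ) (x : ℕ) : Fin (r+1) :=
  (colAt lam univ x).1

/-- Edge multiplicities of the multigraph `G^σ`: the number of inversion pairs of `σ`
colored by `{i, j}`. -/
def eG {r : ℕ} (lam : Fin (r+1) → ℕ → ℕ) (σ : (ℕ × ℕ) → ℕ) (i j : Fin (r+1)) : ℕ :=
  ((invPairs (lamB lam univ) σ).filter (fun pr =>
    (colColor lam pr.1.1 = i ∧ colColor lam pr.2.1 = j) ∨
    (colColor lam pr.1.1 = j ∧ colColor lam pr.2.1 = i))).card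

/-- Edge multiplicities of the multigraph `G^{□_1,…,□_s}` attached to a set `D` of boxes:
for each box of `D` and each box strictly to its left in the same row, one edge joining
the colors of the two columns. -/
def eBox {r : ℕ} (lam : Fin (r+1) → ℕ → ℕ) (D : Finset (ℕ × ℕ)) (i j : Fin (r+1)) : ℕ :=
  ((D ×ˢ cells (lamB lam univ)).filter (fun pr =>
    pr.2.2 = pr.1.2 ∧ pr.2.1 < pr.1.1 ∧
      ((colColor lam pr.2.1 = i ∧ colColor lam pr.1.1 = j) ∨
       (colColor lam pr.2.1 = j ∧ colColor lam pr.1.1 = i)))).card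

theorem mem_setPartitions {α : Type*} {π : Finset (Finset α)} {H : Finset α} :
    π ∈ setPartitions H ↔ IsSetPartition π H := by
  simp only [setPartitions, mem_filter, mem_powerset, and_iff_right_iff_imp]
  intro h B hB
  exact mem_powerset.2 (h.1 B hB)

/-- The Möbius function of the partition lattice at a set partition with `k` blocks. -/
def moebiusCoeff (A : Type*) [CommRing A] (k : ℕ) : A :=
  (-1 : A) ^ (k - 1) * ((k - 1).factorial : A)

theorem moebiusCoeff_add_mul {A : Type*} [CommRing A] {k : ℕ} (hk : 2 ≤ k) :
    moebiusCoeff A k + ((k - 1 : ℕ) : A) * moebiusCoeff A (k - 1) = 0 := by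
  obtain ⟨n, rfl⟩ := Nat.exists_eq_add_of_le' hk
  simp [moebiusCoeff, pow_succ, Nat.factorial_succ]
  ring

theorem IsSetPartition.insert_sdiff {α : Type*} [DecidableEq α] {π : Finset (Finset α)}
    {D H : Finset α} (h : IsSetPartition π D) (hD : D ⊆ H) (hne : D ≠ H) :
    IsSetPartition (insert (H \ D) π) H ∧ H \ D ∉ π := by
  obtain ⟨h1, h2, h3, h4⟩ := h
  have hdisj : ∀ B ∈ π, Disjoint (H \ D) B := fun B hB =>
    disjoint_sdiff_self_left.mono_right (h1 B hB)
  refine ⟨⟨?_, ?_, ?_, ?_⟩, fun hmem => ?_⟩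
  · intro B hB
    rcases mem_insert.1 hB with rfl | hB
    · exact sdiff_subset
    · exact (h1 B hB).trans hD
  · intro B hB
    rcases mem_insert.1 hB with rfl | hB
    · exact sdiff_nonempty.2 fun h => hne (hD.antisymm h)
    · exact h2 B hB
  · intro B hB C hC hBC
    rcases mem_insert.1 hB with rfl | hB <;> rcases mem_insert.1 hC with rfl | hC
    · exact absurd rfl hBC
    · exact hdisj C hC
    · exact (hdisj B hB).symm
    · exact h3 B hB C hC hBC
  · intro a ha
    by_cases haD : a ∈ D
    · obtain ⟨B, hB, haB⟩ := h4 a haD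
      exact ⟨B, mem_insert_of_mem hB, haB⟩
    · exact ⟨_, mem_insert_self _ _, mem_sdiff.2 ⟨ha, haD⟩⟩
  · obtain ⟨x, hx⟩ := h2 _ hmem
    exact (mem_sdiff.1 hx).2 (h1 _ hmem hx)

theorem IsSetPartition.erase {α : Type*} [DecidableEq α] {ρ : Finset (Finset α)}
    {C H : Finset α} (h : IsSetPartition ρ H) (hC : C ∈ ρ) :
    IsSetPartition (ρ.erase C) (H \ C) := by
  obtain ⟨h1, h2, h3, h4⟩ := h
  refine ⟨?_, ?_, ?_, ?_⟩
  · intro B hB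
    obtain ⟨hne, hB⟩ := mem_erase.1 hB
    exact subset_sdiff.2 ⟨h1 B hB, h3 B hB C hC hne⟩
  · exact fun B hB => h2 B (mem_of_mem_erase hB)
  · exact fun B hB B' hB' => h3 B (mem_of_mem_erase hB) B' (mem_of_mem_erase hB')
  · intro a ha
    obtain ⟨ha, haC⟩ := mem_sdiff.1 ha
    obtain ⟨B, hB, haB⟩ := h4 a ha
    exact ⟨B, mem_erase.2 ⟨fun h => haC (h ▸ haB), hB⟩, haB⟩

theorem IsSetPartition.card_filter_notMem {α : Type*} [DecidableEq α] {ρ : Finset (Finset α)}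
    {H : Finset α} (h : IsSetPartition ρ H) {v : α} (hv : v ∈ H) :
    (ρ.filter fun C => v ∉ C).card = ρ.card - 1 := by
  obtain ⟨h1, h2, h3, h4⟩ := h
  obtain ⟨B, hB, hvB⟩ := h4 v hv
  have : (ρ.filter fun C => v ∉ C) = ρ.erase B := by
    ext C
    simp only [mem_filter, mem_erase]
    constructor
    · rintro ⟨hC, hvC⟩
      exact ⟨fun h => hvC (h ▸ hvB), hC⟩
    · rintro ⟨hne, hC⟩
      exact ⟨hC, fun hvC => disjoint_left.1 (h3 C hC B hB hne) hvC hvB⟩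
  rw [this, card_erase_of_mem hB]

theorem IsSetPartition.eq_singleton {α : Type*} {ρ : Finset (Finset α)}
    {H : Finset α} (h : IsSetPartition ρ H) (hH : H.Nonempty) (hρ : ρ.card < 2) : ρ = {H} := by
  obtain ⟨h1, h2, h3, h4⟩ := h
  obtain ⟨v, hv⟩ := hH
  obtain ⟨B, hB, hvB⟩ := h4 v hv
  have hρB : ∀ C ∈ ρ, C = B := fun C hC => card_le_one.1 (Nat.lt_succ_iff.1 hρ) C hC B hB
  have hBH : B = H := (h1 B hB).antisymm fun a ha => by
    obtain ⟨C, hC, haC⟩ := h4 a ha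
    exact hρB C hC ▸ haC
  subst hBH
  exact eq_singleton_iff_unique_mem.2 ⟨hB, hρB⟩

theorem isSetPartition_singleton {α : Type*} {H : Finset α} (hH : H.Nonempty) :
    IsSetPartition {H} H := by
  refine ⟨by simp, by simpa using hH, ?_, fun a ha => ⟨H, by simp, ha⟩⟩
  intro B hB C hC hne
  exact absurd ((mem_singleton.1 hB).trans (mem_singleton.1 hC).symm) hne

theorem sum_properSubset_jointCumulant {A : Type*} [CommRing A] {α : Type*} [DecidableEq α]
    (u : Finset α → A) {H : Finset α} {v : α} (hv : v ∈ H) :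
    ∑ D ∈ (H.powerset.filter fun D => v ∈ D).erase H, jointCumulant u D * u (H \ D) =
      ∑ ρ ∈ setPartitions H,
        ((ρ.card - 1 : ℕ) : A) * moebiusCoeff A (ρ.card - 1) * ∏ B ∈ ρ, u B := by
  have h1 : ∀ ρ ∈ setPartitions H,
      ((ρ.card - 1 : ℕ) : A) * moebiusCoeff A (ρ.card - 1) * ∏ B ∈ ρ, u B =
        ∑ C ∈ ρ.filter (fun C => v ∉ C), moebiusCoeff A (ρ.card - 1) * ∏ B ∈ ρ, u B := by
    intro ρ hρ
    rw [sum_const, (mem_setPartitions.1 hρ).card_filter_notMem hv, nsmul_eq_mul, mul_assoc]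
  rw [sum_congr rfl h1]
  simp only [jointCumulant, sum_mul]
  rw [sum_sigma', sum_sigma']
  refine sum_nbij' (fun x => ⟨insert (H \ x.1) x.2, H \ x.1⟩)
    (fun x => ⟨H \ x.2, x.1.erase x.2⟩) ?_ ?_ ?_ ?_ ?_
  · rintro ⟨D, π⟩ h
    simp only [mem_sigma, mem_erase, mem_filter, mem_powerset, mem_setPartitions] at h ⊢
    obtain ⟨⟨hne, hD, hvD⟩, hπ⟩ := h
    exact ⟨(hπ.insert_sdiff hD hne).1, mem_insert_self _ _, fun h => (mem_sdiff.1 h).2 hvD⟩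
  · rintro ⟨ρ, C⟩ h
    simp only [mem_sigma, mem_erase, mem_filter, mem_powerset, mem_setPartitions] at h ⊢
    obtain ⟨hρ, hC, hvC⟩ := h
    refine ⟨⟨fun h => ?_, sdiff_subset, mem_sdiff.2 ⟨hv, hvC⟩⟩, hρ.erase hC⟩
    obtain ⟨x, hx⟩ := hρ.2.1 C hC
    exact (mem_sdiff.1 (h.symm ▸ hρ.1 C hC hx)).2 hx
  · rintro ⟨D, π⟩ h
    simp only [mem_sigma, mem_erase, mem_filter, mem_powerset, mem_setPartitions] at h
    obtain ⟨⟨hne, hD, hvD⟩, hπ⟩ := h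
    simp only [Sigma.mk.injEq]
    rw [Finset.sdiff_sdiff_eq_self hD, erase_insert (hπ.insert_sdiff hD hne).2]
    exact ⟨rfl, HEq.rfl⟩
  · rintro ⟨ρ, C⟩ h
    simp only [mem_sigma, mem_filter, mem_setPartitions] at h
    obtain ⟨hρ, hC, hvC⟩ := h
    simp only [Sigma.mk.injEq]
    rw [Finset.sdiff_sdiff_eq_self (hρ.1 C hC), insert_erase hC]
    exact ⟨rfl, HEq.rfl⟩
  · rintro ⟨D, π⟩ h
    simp only [mem_sigma, mem_erase, mem_filter, mem_powerset, mem_setPartitions] at h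
    obtain ⟨⟨hne, hD, hvD⟩, hπ⟩ := h
    have hnot := (hπ.insert_sdiff hD hne).2
    simp only [card_insert_of_notMem hnot, prod_insert hnot, moebiusCoeff, Nat.add_sub_cancel]
    ring

/-- Moments in terms of joint cumulants. -/
theorem sum_jointCumulant_mul {A : Type*} [CommRing A] {α : Type*} [DecidableEq α]
    (u : Finset α → A) (hu : u ∅ = 1) {H : Finset α} {v : α} (hv : v ∈ H) :
    ∑ D ∈ H.powerset.filter (fun D => v ∈ D), jointCumulant u D * u (H \ D) = u H := by
  have hH : H.Nonempty := ⟨v, hv⟩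
  rw [← sum_erase_add _ _ (show H ∈ H.powerset.filter (fun D => v ∈ D) by simp [hv]),
    sum_properSubset_jointCumulant u hv, Finset.sdiff_self, hu, mul_one, jointCumulant,
    ← sum_add_distrib, sum_eq_single {H}]
  · simp [moebiusCoeff]
  · intro ρ hρ hne
    have h2 : 2 ≤ ρ.card := by
      by_contra h
      exact hne ((mem_setPartitions.1 hρ).eq_singleton hH (not_le.1 h))
    have := moebiusCoeff_add_mul (A := A) h2
    rw [moebiusCoeff] at this
    rw [← add_mul, add_comm, this, zero_mul]
  · exact fun h => absurd (mem_setPartitions.2 (isSetPartition_singleton hH)) h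

/-- Removing the vertex `v` from a connected structure: `C` is the component of `w` that remains. -/
theorem cumulant_eq_sum_component {A : Type*} [CommRing A] {α : Type*} [DecidableEq α]
    {u k : Finset α → A} (hu : u ∅ = 1)
    (hk : ∀ H : Finset α, ∀ v ∈ H, ∑ D ∈ H.powerset.filter (fun D => v ∈ D), k D * u (H \ D) = u H)
    {a : α → A} {g : α → Finset α → A}
    (hua : ∀ v X, v ∉ X → u (insert v X) = a v * g v X * u X)
    (hg : ∀ v X Y, Disjoint X Y → g v (X ∪ Y) = g v X * g v Y)
    {v w : α} (hvw : v ≠ w) (H : Finset α) (hv : v ∈ H) (hw : w ∈ H) :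
    k H = ∑ C ∈ H.powerset.filter (fun C => w ∈ C ∧ v ∉ C), k C * (g v C - 1) * k (H \ C) := by
  induction H using Finset.strongInduction with
  | H H ih =>
  set k' : Finset α → A := fun H =>
    ∑ C ∈ H.powerset.filter (fun C => w ∈ C ∧ v ∉ C), k C * (g v C - 1) * k (H \ C) with hk'
  have hswap : ∑ D ∈ H.powerset.filter (fun D => v ∈ D ∧ w ∈ D), k' D * u (H \ D) =
      ∑ C ∈ H.powerset.filter (fun C => w ∈ C ∧ v ∉ C), k C * (g v C - 1) *
        ∑ E ∈ (H \ C).powerset.filter (fun E => v ∈ E), k E * u ((H \ C) \ E) := by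
    simp only [hk', sum_mul, mul_sum]
    rw [sum_sigma', sum_sigma']
    refine sum_nbij' (fun x => ⟨x.2, x.1 \ x.2⟩) (fun x => ⟨x.1 ∪ x.2, x.1⟩) ?_ ?_ ?_ ?_ ?_
    · rintro ⟨D, C⟩ h
      simp only [mem_sigma, mem_filter, mem_powerset] at h ⊢
      obtain ⟨⟨hD, hvD, hwD⟩, hC, hwC, hvC⟩ := h
      exact ⟨⟨hC.trans hD, hwC, hvC⟩, sdiff_subset_sdiff hD subset_rfl, mem_sdiff.2 ⟨hvD, hvC⟩⟩
    · rintro ⟨C, E⟩ h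
      simp only [mem_sigma, mem_filter, mem_powerset] at h ⊢
      obtain ⟨⟨hC, hwC, hvC⟩, hE, hvE⟩ := h
      exact ⟨⟨union_subset hC (hE.trans sdiff_subset), mem_union_right _ hvE,
        mem_union_left _ hwC⟩, subset_union_left, hwC, hvC⟩
    · rintro ⟨D, C⟩ h
      simp only [mem_sigma, mem_filter, mem_powerset] at h
      simp only [union_sdiff_of_subset h.2.1]
    · rintro ⟨C, E⟩ h
      simp only [mem_sigma, mem_filter, mem_powerset] at h
      have : Disjoint E C := (subset_sdiff.1 h.2.1).2
      simp only [union_sdiff_cancel_left this.symm]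
    · rintro ⟨D, C⟩ h
      simp only [mem_sigma, mem_filter, mem_powerset] at h
      have : (H \ C) \ (D \ C) = H \ D := by
        ext x
        have := @h.2.1 x
        simp only [mem_sdiff]
        tauto
      simp only [this]
      ring
  have hconv : ∑ C ∈ H.powerset.filter (fun C => w ∈ C ∧ v ∉ C), k C * g v C * u (H \ C) = u H := by
    have h1 : ∀ C ∈ H.powerset.filter (fun C => w ∈ C ∧ v ∉ C), k C * g v C * u (H \ C) =
        a v * g v (H.erase v) * (k C * u (H.erase v \ C)) := by
      intro C hC
      simp only [mem_filter, mem_powerset] at hC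
      obtain ⟨hC, hwC, hvC⟩ := hC
      have e1 : H \ C = insert v (H.erase v \ C) := by
        ext x
        by_cases hx : x = v
        · subst hx; simp [hv, hvC]
        · simp [hx]
      have e2 : g v (H.erase v) = g v C * g v (H.erase v \ C) := by
        rw [← hg _ _ _ disjoint_sdiff, union_sdiff_of_subset]
        exact fun x hx => mem_erase.2 ⟨fun h => hvC (h ▸ hx), hC hx⟩
      rw [e1, hua _ _ (by simp), e2]
      ring
    have h2 : H.powerset.filter (fun C => w ∈ C ∧ v ∉ C) =
        (H.erase v).powerset.filter (fun C => w ∈ C) := by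
      ext C
      simp only [mem_filter, mem_powerset, subset_erase]
      tauto
    rw [sum_congr rfl h1, ← mul_sum, h2, hk _ _ (mem_erase.2 ⟨hvw.symm, hw⟩),
      ← hua _ _ (notMem_erase v H), insert_erase hv]
  have hboth : ∑ D ∈ H.powerset.filter (fun D => v ∈ D ∧ w ∈ D), k' D * u (H \ D) =
      ∑ D ∈ H.powerset.filter (fun D => v ∈ D ∧ w ∈ D), k D * u (H \ D) := by
    have h3 : ∀ C ∈ H.powerset.filter (fun C => w ∈ C ∧ v ∉ C), k C * (g v C - 1) *
        ∑ E ∈ (H \ C).powerset.filter (fun E => v ∈ E), k E * u ((H \ C) \ E) =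
        k C * g v C * u (H \ C) - k C * u (H \ C) := by
      intro C hC
      simp only [mem_filter, mem_powerset] at hC
      rw [hk _ _ (mem_sdiff.2 ⟨hv, hC.2.2⟩)]
      ring
    rw [hswap, sum_congr rfl h3, sum_sub_distrib, hconv, sub_eq_iff_eq_add, ← hk H w hw,
      ← sum_filter_add_sum_filter_not _ (fun D => v ∈ D)]
    simp only [filter_filter, and_comm]
  have hmem : H ∈ H.powerset.filter (fun D => v ∈ D ∧ w ∈ D) := by simp [hv, hw]
  rw [← sum_erase_add _ _ hmem, ← sum_erase_add _ _ hmem, Finset.sdiff_self, hu, mul_one, mul_one] at hboth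
  have hlt : ∑ D ∈ (H.powerset.filter (fun D => v ∈ D ∧ w ∈ D)).erase H, k D * u (H \ D) =
      ∑ D ∈ (H.powerset.filter (fun D => v ∈ D ∧ w ∈ D)).erase H, k' D * u (H \ D) := by
    refine sum_congr rfl fun D hD => ?_
    simp only [mem_erase, mem_filter, mem_powerset] at hD
    rw [ih D (hD.2.1.ssubset_of_ne hD.1) hD.2.2.1 hD.2.2.2]
  rw [hlt] at hboth
  exact (add_left_cancel hboth).symm

section RootedTrees

variable {V : Type*} [Fintype V] [DecidableEq V]

/-- `p` is the parent map of a tree with vertex set `B` rooted at `v`, extended by the identity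
outside `B`. -/
def IsRootedTree (B : Finset V) (v : V) (p : V → V) : Prop :=
  (∀ x, x ∉ B → p x = x) ∧ p v = v ∧ (∀ x ∈ B, p x ∈ B) ∧ ∀ x ∈ B, ∃ k, p^[k] x = v

/-- The trees with vertex set `B` rooted at `v`. -/
def rootedTrees (B : Finset V) (v : V) : Finset (V → V) :=
  univ.filter fun p => IsRootedTree B v p

/-- The vertices whose path to the root passes through `i` (including `i` itself). -/
def descendants (p : V → V) (i : V) : Finset V :=
  univ.filter fun x => ∃ k, p^[k] x = i

/-- The sum over all trees on `B` rooted at `v` of the product of local weights depending on a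
vertex, its parent and its descendants. -/
def treeSum {A : Type*} [CommRing A] (f : V → V → Finset V → A) (B : Finset V) (v : V) : A :=
  ∑ p ∈ rootedTrees B v, ∏ i ∈ B.erase v, f i (p i) (descendants p i)

/-- Attach the tree `p₁` on `D` rooted at `w` to the vertex `v` of the tree `p₂`. -/
def graft (D : Finset V) (w v : V) (p₁ p₂ : V → V) (x : V) : V :=
  if x = w then v else if x ∈ D then p₁ x else p₂ x

theorem mem_rootedTrees {B : Finset V} {v : V} {p : V → V} :
    p ∈ rootedTrees B v ↔ IsRootedTree B v p := by
  simp [rootedTrees]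

omit [DecidableEq V] in
theorem mem_descendants {p : V → V} {i x : V} : x ∈ descendants p i ↔ ∃ k, p^[k] x = i := by
  simp [descendants]

omit [DecidableEq V] in
theorem self_mem_descendants (p : V → V) (i : V) : i ∈ descendants p i :=
  mem_descendants.2 ⟨0, rfl⟩

omit [DecidableEq V] in
theorem mem_descendants_of_apply {p : V → V} {i x : V} (h : p x ∈ descendants p i) :
    x ∈ descendants p i := by
  obtain ⟨k, hk⟩ := mem_descendants.1 h
  exact mem_descendants.2 ⟨k + 1, hk⟩

omit [DecidableEq V] in
theorem apply_mem_descendants {p : V → V} {i x : V} (h : x ∈ descendants p i) (hx : x ≠ i) :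
    p x ∈ descendants p i := by
  obtain ⟨k, hk⟩ := mem_descendants.1 h
  cases k with
  | zero => exact absurd hk hx
  | succ k => exact mem_descendants.2 ⟨k, hk⟩

theorem IsRootedTree.descendants_subset {B : Finset V} {v i : V} {p : V → V}
    (hp : IsRootedTree B v p) (hi : i ∈ B) : descendants p i ⊆ B := by
  intro x hx
  obtain ⟨k, hk⟩ := mem_descendants.1 hx
  by_contra hxB
  rw [Function.iterate_fixed (hp.1 x hxB)] at hk
  exact hxB (hk ▸ hi)

theorem IsRootedTree.descendants_root {B : Finset V} {v : V} {p : V → V}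
    (hp : IsRootedTree B v p) (hv : v ∈ B) : descendants p v = B :=
  (hp.descendants_subset hv).antisymm fun x hx => mem_descendants.2 (hp.2.2.2 x hx)

omit [DecidableEq V] in
/-- Two children of the root with a common descendant are equal. -/
theorem child_unique {v w w' u : V} {p : V → V} (hpv : p v = v) (hw : w ≠ v) (hw' : w' ≠ v)
    (hpw : p w = v) (hpw' : p w' = v) (hu : u ∈ descendants p w) (hu' : u ∈ descendants p w') :
    w = w' := by
  obtain ⟨a, ha⟩ := mem_descendants.1 hu
  obtain ⟨b, hb⟩ := mem_descendants.1 hu'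
  have key : ∀ {w w' : V} {a b : ℕ}, w' ≠ v → p w = v → p^[a] u = w → p^[b] u = w' → b ≤ a := by
    intro w w' a b hw' hpw ha hb
    by_contra! hlt
    obtain ⟨d, rfl⟩ := Nat.exists_eq_add_of_lt hlt
    rw [show a + d + 1 = (d + 1) + a by ring, Function.iterate_add_apply, ha,
      Function.iterate_succ_apply, hpw, Function.iterate_fixed hpv] at hb
    exact hw' hb.symm
  have : a = b := le_antisymm (key hw hpw' hb ha) (key hw' hpw ha hb)
  rw [← ha, ← hb, this]

section Graft

variable {B D : Finset V} {v w : V} {p₁ p₂ : V → V}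

omit [Fintype V] in
theorem graft_of_notMem (hw : w ∈ D) {x : V} (hx : x ∉ D) : graft D w v p₁ p₂ x = p₂ x := by
  have hxw : x ≠ w := fun h => hx (h ▸ hw)
  rw [graft, if_neg hxw, if_neg hx]

omit [Fintype V] in
theorem graft_of_mem {x : V} (hx : x ∈ D) (hxw : x ≠ w) : graft D w v p₁ p₂ x = p₁ x := by
  rw [graft, if_neg hxw, if_pos hx]

omit [Fintype V] in
theorem graft_self : graft D w v p₁ p₂ w = v := if_pos rfl

omit [Fintype V] in
theorem notMem_of_isRootedTree_sdiff (h₂ : IsRootedTree (B \ D) v p₂) {x : V} (hx : x ∉ D) :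
    p₂ x ∉ D := by
  by_cases hxB : x ∈ B
  · exact (mem_sdiff.1 (h₂.2.2.1 x (mem_sdiff.2 ⟨hxB, hx⟩))).2
  · rwa [h₂.1 x fun h => hxB (mem_sdiff.1 h).1]

omit [Fintype V] in
theorem graft_iterate_of_notMem (hw : w ∈ D) (h₂ : IsRootedTree (B \ D) v p₂) (k : ℕ) {x : V}
    (hx : x ∉ D) : (graft D w v p₁ p₂)^[k] x = p₂^[k] x := by
  induction k generalizing x with
  | zero => rfl
  | succ k ih =>
    rw [Function.iterate_succ_apply, Function.iterate_succ_apply, graft_of_notMem hw hx,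
      ih (notMem_of_isRootedTree_sdiff h₂ hx)]

omit [Fintype V] in
theorem iterate_notMem (h₂ : IsRootedTree (B \ D) v p₂) (k : ℕ) {x : V}
    (hx : x ∉ D) : p₂^[k] x ∉ D := by
  induction k generalizing x with
  | zero => exact hx
  | succ k ih => exact ih (notMem_of_isRootedTree_sdiff h₂ hx)

theorem descendants_graft_of_mem (hvD : v ∉ D) (hw : w ∈ D) (h₁ : IsRootedTree D w p₁)
    (h₂ : IsRootedTree (B \ D) v p₂) {i : V} (hi : i ∈ D) :
    descendants (graft D w v p₁ p₂) i = descendants p₁ i := by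
  ext x
  by_cases hx : x ∈ D
  · constructor
    · intro h
      obtain ⟨k, hk⟩ := mem_descendants.1 h
      clear h
      induction k generalizing x with
      | zero => exact mem_descendants.2 ⟨0, hk⟩
      | succ k ih =>
        rw [Function.iterate_succ_apply] at hk
        by_cases hxw : x = w
        · subst hxw
          rw [graft_self, graft_iterate_of_notMem hw h₂ k hvD] at hk
          exact absurd (hk ▸ hi) (iterate_notMem h₂ k hvD)
        · rw [graft_of_mem hx hxw] at hk
          exact mem_descendants_of_apply (ih _ (h₁.2.2.1 x hx) hk)
    · intro h
      obtain ⟨k, hk⟩ := mem_descendants.1 h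
      clear h
      induction k generalizing x with
      | zero => exact mem_descendants.2 ⟨0, hk⟩
      | succ k ih =>
        by_cases hxw : x = w
        · subst hxw
          rw [Function.iterate_fixed h₁.2.1] at hk
          exact mem_descendants.2 ⟨0, hk⟩
        · refine mem_descendants_of_apply ?_
          rw [graft_of_mem hx hxw]
          exact ih _ (h₁.2.2.1 x hx) hk
  · refine iff_of_false (fun h => ?_) fun h => hx (h₁.descendants_subset hi h)
    obtain ⟨k, hk⟩ := mem_descendants.1 h
    rw [graft_iterate_of_notMem hw h₂ k hx] at hk
    exact iterate_notMem h₂ k hx (hk ▸ hi)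

omit [Fintype V] in
theorem graft_iterate_of_mem (hvD : v ∉ D) (hw : w ∈ D) (h₁ : IsRootedTree D w p₁)
    (h₂ : IsRootedTree (B \ D) v p₂) (k : ℕ) {x : V} (hx : x ∈ D) :
    (graft D w v p₁ p₂)^[k] x ∈ D ∨ (graft D w v p₁ p₂)^[k] x = v := by
  induction k generalizing x with
  | zero => exact Or.inl hx
  | succ k ih =>
    rw [Function.iterate_succ_apply]
    by_cases hxw : x = w
    · subst hxw
      rw [graft_self, graft_iterate_of_notMem hw h₂ k hvD, Function.iterate_fixed h₂.2.1]
      exact Or.inr rfl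
    · rw [graft_of_mem hx hxw]
      exact ih (h₁.2.2.1 x hx)

theorem descendants_graft_of_notMem (hvD : v ∉ D) (hw : w ∈ D) (h₁ : IsRootedTree D w p₁)
    (h₂ : IsRootedTree (B \ D) v p₂) {i : V} (hi : i ∉ D) (hiv : i ≠ v) :
    descendants (graft D w v p₁ p₂) i = descendants p₂ i := by
  ext x
  by_cases hx : x ∈ D
  · refine iff_of_false (fun h => ?_) (fun h => ?_)
    · obtain ⟨k, hk⟩ := mem_descendants.1 h
      rcases graft_iterate_of_mem hvD hw h₁ h₂ k hx with h | h
      · exact hi (hk ▸ h)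
      · exact hiv (hk.symm.trans h)
    · obtain ⟨k, hk⟩ := mem_descendants.1 h
      rw [Function.iterate_fixed (h₂.1 x fun h => (mem_sdiff.1 h).2 hx)] at hk
      exact hi (hk ▸ hx)
  · simp only [mem_descendants, graft_iterate_of_notMem hw h₂ _ hx]

theorem isRootedTree_graft (hD : D ⊆ B) (hv : v ∈ B) (hvD : v ∉ D) (hw : w ∈ D)
    (h₁ : IsRootedTree D w p₁) (h₂ : IsRootedTree (B \ D) v p₂) :
    IsRootedTree B v (graft D w v p₁ p₂) := by
  refine ⟨fun x hx => ?_, ?_, fun x hx => ?_, fun x hx => ?_⟩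
  · rw [graft_of_notMem hw fun h => hx (hD h), h₂.1 x fun h => hx (mem_sdiff.1 h).1]
  · rw [graft_of_notMem hw hvD, h₂.2.1]
  · by_cases hxD : x ∈ D
    · by_cases hxw : x = w
      · rwa [hxw, graft_self]
      · rw [graft_of_mem hxD hxw]
        exact hD (h₁.2.2.1 x hxD)
    · rw [graft_of_notMem hw hxD]
      exact (mem_sdiff.1 (h₂.2.2.1 x (mem_sdiff.2 ⟨hx, hxD⟩))).1
  · by_cases hxD : x ∈ D
    · have : x ∈ descendants (graft D w v p₁ p₂) w := by
        rwa [descendants_graft_of_mem hvD hw h₁ h₂ hw, h₁.descendants_root hw]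
      obtain ⟨k, hk⟩ := mem_descendants.1 this
      exact ⟨k + 1, by rw [Function.iterate_succ_apply', hk, graft_self]⟩
    · obtain ⟨k, hk⟩ := h₂.2.2.2 x (mem_sdiff.2 ⟨hx, hxD⟩)
      exact ⟨k, by rw [graft_iterate_of_notMem hw h₂ k hxD, hk]⟩

end Graft

section Prune

variable {B : Finset V} {v w : V} {p : V → V}

omit [DecidableEq V] in
theorem IsRootedTree.root_notMem_descendants (hp : IsRootedTree B v p) (hwv : w ≠ v) :
    v ∉ descendants p w := by
  intro h
  obtain ⟨k, hk⟩ := mem_descendants.1 h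
  rw [Function.iterate_fixed hp.2.1] at hk
  exact hwv hk.symm

theorem isRootedTree_branch (w : V) (p : V → V) :
    IsRootedTree (descendants p w) w
      fun x => if x = w then w else if x ∈ descendants p w then p x else x := by
  refine ⟨fun x hx => ?_, by simp, fun x hx => ?_, fun x hx => ?_⟩
  · have : x ≠ w := fun h => hx (h ▸ self_mem_descendants p w)
    simp [this, hx]
  · by_cases hxw : x = w
    · simp [hxw, self_mem_descendants]
    · simp only [hxw, if_false, hx, if_true]
      exact apply_mem_descendants hx hxw
  · obtain ⟨k, hk⟩ := mem_descendants.1 hx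
    induction k generalizing x with
    | zero => exact ⟨0, hk⟩
    | succ k ih =>
      by_cases hxw : x = w
      · exact ⟨0, hxw⟩
      · obtain ⟨m, hm⟩ := ih (p x) (apply_mem_descendants hx hxw) hk
        refine ⟨m + 1, ?_⟩
        rw [Function.iterate_succ_apply]
        simpa only [hxw, if_false, hx, if_true] using hm

theorem isRootedTree_prune (hwv : w ≠ v) (hp : IsRootedTree B v p) :
    IsRootedTree (B \ descendants p w) v fun x => if x ∈ descendants p w then x else p x := by
  have hv := hp.root_notMem_descendants hwv
  refine ⟨fun x hx => ?_, by simp [hv, hp.2.1], fun x hx => ?_, fun x hx => ?_⟩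
  · by_cases hxD : x ∈ descendants p w
    · simp [hxD]
    · simp [hxD, hp.1 x fun h => hx (mem_sdiff.2 ⟨h, hxD⟩)]
  · obtain ⟨hxB, hxD⟩ := mem_sdiff.1 hx
    simp only [hxD, if_false]
    exact mem_sdiff.2 ⟨hp.2.2.1 x hxB, fun h => hxD (mem_descendants_of_apply h)⟩
  · obtain ⟨hxB, hxD⟩ := mem_sdiff.1 hx
    obtain ⟨k, hk⟩ := hp.2.2.2 x hxB
    refine ⟨k, ?_⟩
    rw [← hk]
    clear hk hx hxB
    induction k generalizing x with
    | zero => rfl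
    | succ k ih =>
      rw [Function.iterate_succ_apply, Function.iterate_succ_apply]
      simp only [hxD, if_false]
      exact ih _ fun h => hxD (mem_descendants_of_apply h)

theorem graft_branch_prune (hpw : p w = v) :
    graft (descendants p w) w v
      (fun x => if x = w then w else if x ∈ descendants p w then p x else x)
      (fun x => if x ∈ descendants p w then x else p x) = p := by
  funext x
  by_cases hxw : x = w
  · rw [hxw, graft_self, hpw]
  · by_cases hx : x ∈ descendants p w
    · simp [graft, hxw, hx]
    · simp [graft, hxw, hx]

theorem IsRootedTree.exists_child (hp : IsRootedTree B v p) {u : V} (hu : u ∈ B) (huv : u ≠ v) :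
    ∃ w ∈ B, w ≠ v ∧ p w = v ∧ u ∈ descendants p w := by
  obtain ⟨k, hk⟩ := hp.2.2.2 u hu
  induction k generalizing u with
  | zero => exact absurd hk huv
  | succ k ih =>
    by_cases h : p u = v
    · exact ⟨u, hu, huv, h, self_mem_descendants p u⟩
    · obtain ⟨w, hw, hwv, hpw, huw⟩ := ih (hp.2.2.1 u hu) h hk
      exact ⟨w, hw, hwv, hpw, mem_descendants_of_apply huw⟩

end Prune

/-- Decomposition of a tree rooted at `v` into the branch at `v` containing `u` and the rest. -/
theorem treeSum_eq_sum_branch {A : Type*} [CommRing A] (f : V → V → Finset V → A) {B : Finset V}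
    {v u : V} (hv : v ∈ B) (hu : u ∈ B) (huv : u ≠ v) :
    treeSum f B v = ∑ D ∈ B.powerset.filter (fun D => u ∈ D ∧ v ∉ D), ∑ w ∈ D,
      f w v D * treeSum f D w * treeSum f (B \ D) v := by
  have hexp : ∀ D : Finset V, ∀ w : V, f w v D * treeSum f D w * treeSum f (B \ D) v =
      ∑ p ∈ rootedTrees D w ×ˢ rootedTrees (B \ D) v,
        f w v D * (∏ i ∈ D.erase w, f i (p.1 i) (descendants p.1 i)) *
          ∏ i ∈ (B \ D).erase v, f i (p.2 i) (descendants p.2 i) := by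
    intro D w
    simp only [treeSum, mul_sum, sum_mul, sum_product]
    rw [sum_comm]
  simp only [hexp]
  rw [sum_sigma', sum_sigma', treeSum]
  symm
  refine sum_bij (fun x _ => graft x.1.1 x.1.2 v x.2.1 x.2.2) ?_ ?_ ?_ ?_
  · rintro ⟨⟨D, w⟩, p₁, p₂⟩ h
    simp only [mem_sigma, mem_filter, mem_powerset, mem_product, mem_rootedTrees] at h ⊢
    obtain ⟨⟨⟨hD, huD, hvD⟩, hw⟩, h₁, h₂⟩ := h
    exact isRootedTree_graft hD hv hvD hw h₁ h₂
  · rintro ⟨⟨D, w⟩, p₁, p₂⟩ h ⟨⟨D', w'⟩, p₁', p₂'⟩ h' heq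
    simp only [mem_sigma, mem_filter, mem_powerset, mem_product, mem_rootedTrees] at h h'
    obtain ⟨⟨⟨hD, huD, hvD⟩, hw⟩, h₁, h₂⟩ := h
    obtain ⟨⟨⟨hD', huD', hvD'⟩, hw'⟩, h₁', h₂'⟩ := h'
    simp only at heq huD huD' hvD hvD' hw hw' h₁ h₂ h₁' h₂'
    have hdw : descendants (graft D w v p₁ p₂) w = D := by
      rw [descendants_graft_of_mem hvD hw h₁ h₂ hw, h₁.descendants_root hw]
    have hdw' : descendants (graft D w v p₁ p₂) w' = D' := by
      rw [heq, descendants_graft_of_mem hvD' hw' h₁' h₂' hw', h₁'.descendants_root hw']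
    have hww : w = w' := by
      refine child_unique (p := graft D w v p₁ p₂) (u := u)
        (isRootedTree_graft hD hv hvD hw h₁ h₂).2.1
        (fun h => hvD (h ▸ hw)) (fun h => hvD' (h ▸ hw')) graft_self ?_
        (hdw.symm ▸ huD) (hdw'.symm ▸ huD')
      rw [heq, graft_self]
    subst hww
    obtain rfl : D = D' := hdw.symm.trans hdw'
    have e1 : p₁ = p₁' := by
      funext x
      by_cases hx : x ∈ D
      · by_cases hxw : x = w
        · rw [hxw, h₁.2.1, h₁'.2.1]
        · rw [← graft_of_mem (v := v) (p₁ := p₁) (p₂ := p₂) hx hxw, heq, graft_of_mem hx hxw]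
      · rw [h₁.1 x hx, h₁'.1 x hx]
    have e2 : p₂ = p₂' := by
      funext x
      by_cases hx : x ∈ D
      · have : x ∉ B \ D := fun h => (mem_sdiff.1 h).2 hx
        rw [h₂.1 x this, h₂'.1 x this]
      · rw [← graft_of_notMem (v := v) (p₁ := p₁) (p₂ := p₂) hw hx, heq, graft_of_notMem hw hx]
    rw [e1, e2]
  · intro p hp
    rw [mem_rootedTrees] at hp
    obtain ⟨w, hw, hwv, hpw, huw⟩ := hp.exists_child hu huv
    refine ⟨⟨⟨descendants p w, w⟩,
      fun x => if x = w then w else if x ∈ descendants p w then p x else x,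
      fun x => if x ∈ descendants p w then x else p x⟩, ?_, graft_branch_prune hpw⟩
    simp only [mem_sigma, mem_filter, mem_powerset, mem_product, mem_rootedTrees]
    exact ⟨⟨⟨hp.descendants_subset hw, huw, hp.root_notMem_descendants hwv⟩,
      self_mem_descendants p w⟩, isRootedTree_branch w p, isRootedTree_prune hwv hp⟩
  · rintro ⟨⟨D, w⟩, p₁, p₂⟩ h
    simp only [mem_sigma, mem_filter, mem_powerset, mem_product, mem_rootedTrees] at h ⊢
    obtain ⟨⟨⟨hD, huD, hvD⟩, hw⟩, h₁, h₂⟩ := h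
    have hB : B.erase v = D ∪ (B \ D).erase v := by
      rw [← erase_eq_of_notMem hvD, ← erase_union_distrib, erase_eq_of_notMem hvD,
        union_sdiff_of_subset hD]
    have hdisj : Disjoint D ((B \ D).erase v) := disjoint_sdiff.mono_right (erase_subset _ _)
    rw [hB, prod_union hdisj, ← mul_prod_erase D _ hw, graft_self,
      descendants_graft_of_mem hvD hw h₁ h₂ hw, h₁.descendants_root hw]
    congr 1
    · congr 1
      refine prod_congr rfl fun i hi => ?_
      obtain ⟨hiw, hiD⟩ := mem_erase.1 hi
      rw [graft_of_mem hiD hiw, descendants_graft_of_mem hvD hw h₁ h₂ hiD]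
    · refine prod_congr rfl fun i hi => ?_
      obtain ⟨hiv, hi⟩ := mem_erase.1 hi
      have hiD := (mem_sdiff.1 hi).2
      rw [graft_of_notMem hw hiD, descendants_graft_of_notMem hvD hw h₁ h₂ hiD hiv]

theorem treeSum_singleton {A : Type*} [CommRing A] (f : V → V → Finset V → A) (v : V) :
    treeSum f {v} v = 1 := by
  have : rootedTrees {v} v = {id} := by
    ext p
    rw [mem_rootedTrees, mem_singleton]
    constructor
    · intro h
      funext x
      by_cases hx : x = v
      · rw [hx, h.2.1, id]
      · exact h.1 x (by simpa using hx)
    · rintro rfl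
      exact ⟨fun x _ => rfl, rfl, fun x hx => hx, fun x hx => ⟨0, mem_singleton.1 hx⟩⟩
  simp [treeSum, this]

end RootedTrees

theorem nq_mul_sub_one {A : Type*} [CommRing A] (q : A) (m : ℕ) : nq q m * (q - 1) = q ^ m - 1 :=
  geom_sum_mul q m

theorem sum_nq_telescope {A V : Type*} [CommRing A] [LinearOrder V] (q : A) (d : V → ℕ)
    (C : Finset V) :
    ∑ w ∈ C, q ^ (∑ j ∈ C.filter (· < w), d j) * nq q (d w) * (q - 1) =
      q ^ (∑ j ∈ C, d j) - 1 := by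
  induction C using Finset.induction_on_max with
  | empty => simp
  | insert a s hs ih =>
    have ha : a ∉ s := fun h => lt_irrefl _ (hs a h)
    have hlt : ∀ w ∈ s, (insert a s).filter (· < w) = s.filter (· < w) := fun w hw => by
      rw [filter_insert, if_neg (hs w hw).not_gt]
    have hfa : (insert a s).filter (· < a) = s := by
      rw [filter_insert, if_neg (lt_irrefl a), filter_true_of_mem hs]
    have hsum : ∑ w ∈ s, q ^ (∑ j ∈ (insert a s).filter (· < w), d j) * nq q (d w) * (q - 1) =
        q ^ (∑ j ∈ s, d j) - 1 := by
      rw [← ih]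
      exact sum_congr rfl fun w hw => by rw [hlt w hw]
    rw [sum_insert ha, sum_insert ha, hsum, hfa, mul_assoc, nq_mul_sub_one, pow_add]
    ring

section GraphIdentity

variable {V : Type*} [Fintype V] [LinearOrder V]

/-- The number of unordered pairs colored by `{i, j}` when `c i j` counts the ordered ones. -/
def symCount (c : V → V → ℕ) (i j : V) : ℕ := if i = j then c i i else c i j + c j i

/-- The weight of a vertex `i` with parent `p` and set of descendants `D`. -/
def kappaWeight {A : Type*} [CommRing A] (q : A) (e : V → V → ℕ) (i p : V) (D : Finset V) : A :=
  q ^ (∑ j ∈ D.filter (· < i), e p j) * nq q (e i p)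

omit [Fintype V] in
theorem symCount_comm (c : V → V → ℕ) (i j : V) : symCount c i j = symCount c j i := by
  by_cases h : i = j
  · rw [h]
  · rw [symCount, symCount, if_neg h, if_neg (Ne.symm h), add_comm]

/-- The cumulants of `B ↦ q ^ #E(B)`, where `#E(B)` is the number of edges of a multigraph inside
`B`, are weighted sums over spanning trees. -/
theorem jointCumulant_pow_eq_treeSum {A : Type*} [CommRing A] (q : A) (c : V → V → ℕ)
    (B : Finset V) (v : V) (hv : v ∈ B) :
    jointCumulant (fun B => q ^ (∑ i ∈ B, ∑ j ∈ B, c i j)) B =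
      (q - 1) ^ (B.card - 1) * (q ^ (∑ i ∈ B, symCount c i i) *
        treeSum (kappaWeight q (symCount c)) B v) := by
  set u : Finset V → A := fun B => q ^ (∑ i ∈ B, ∑ j ∈ B, c i j) with hu
  have hu0 : u ∅ = 1 := by simp [hu]
  have hconv := fun (H : Finset V) (v : V) (hv : v ∈ H) => sum_jointCumulant_mul u hu0 hv
  induction B using Finset.strongInduction generalizing v with
  | H B ih =>
  by_cases hB : B = {v}
  · subst hB
    have h := hconv {v} v (mem_singleton_self v)
    have hf : ({v} : Finset V).powerset.filter (fun D => v ∈ D) = {{v}} := by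
      ext D
      simp only [mem_filter, mem_powerset, mem_singleton]
      constructor
      · rintro ⟨h, hv⟩
        exact h.antisymm (singleton_subset_iff.2 hv)
      · rintro rfl
        simp
    rw [hf, sum_singleton, Finset.sdiff_self, hu0, mul_one] at h
    rw [h, treeSum_singleton]
    simp [hu, symCount]
  · obtain ⟨w, hw, hwv⟩ : ∃ w ∈ B, w ≠ v := by
      by_contra! h
      exact hB (eq_singleton_iff_unique_mem.2 ⟨hv, h⟩)
    set g : V → Finset V → A := fun v X => q ^ (∑ x ∈ X, (c v x + c x v)) with hg
    rw [cumulant_eq_sum_component hu0 hconv (a := fun v => q ^ c v v) (g := g) ?_ ?_ hwv.symm B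
      hv hw, treeSum_eq_sum_branch _ hv hw hwv, mul_sum, mul_sum]
    · refine sum_congr rfl fun C hC => ?_
      simp only [mem_filter, mem_powerset] at hC
      obtain ⟨hC, hwC, hvC⟩ := hC
      have hgC : g v C = q ^ (∑ j ∈ C, symCount c v j) := by
        simp only [hg]
        congr 1
        refine sum_congr rfl fun x hx => ?_
        have hvx : v ≠ x := fun h => hvC (h ▸ hx)
        rw [symCount, if_neg hvx]
      have hCB : C ⊂ B := hC.ssubset_of_ne fun h => hvC (h ▸ hv)
      have hBC : B \ C ⊂ B := sdiff_ssubset hC ⟨w, hwC⟩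
      have hvBC : v ∈ B \ C := mem_sdiff.2 ⟨hv, hvC⟩
      have hcard : B.card - 1 = (C.card - 1) + ((B \ C).card - 1) + 1 := by
        have h1 := card_sdiff_add_card_eq_card hC
        have h2 := card_pos.2 ⟨w, hwC⟩
        have h3 := card_pos.2 ⟨v, hvBC⟩
        omega
      rw [ih _ hBC v hvBC, hgC, ← sum_nq_telescope, mul_sum, sum_mul, mul_sum, mul_sum]
      refine sum_congr rfl fun x hx => ?_
      rw [ih C hCB x hx, hcard, ← sum_sdiff hC, kappaWeight, symCount_comm c x v]
      ring
    · intro v X hvX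
      simp only [hu, hg, ← pow_add, sum_insert hvX, sum_add_distrib]
      congr 1
      ring
    · intro v X Y hXY
      simp only [hg, sum_union hXY, pow_add]

end GraphIdentity

theorem eq_root_of_iterate_eq_self {V : Type*} {p : V → V} {v i : V} (hv : p v = v) {m n : ℕ}
    (hm : p^[m] i = v) (hn : p^[n + 1] i = i) : i = v := by
  have h : p^[(n + 1) * m] i = i := by
    rw [Function.iterate_mul, Function.iterate_fixed hn]
  rw [show (n + 1) * m = n * m + m by ring, Function.iterate_add_apply, hm,
    Function.iterate_fixed hv] at h
  exact h.symm

theorem kappaStat_eq_sum {r : ℕ} {e : Fin (r+1) → Fin (r+1) → ℕ} (he : ∀ i j, e i j = e j i)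
    {p : Fin (r+1) → Fin (r+1)} (hp : IsRootedTree univ 0 p) :
    kappaStat e p = ∑ i ∈ univ.erase (0 : Fin (r+1)),
      ∑ j ∈ (descendants p i).filter (· < i), e (p i) j := by
  rw [kappaStat, ← sum_finset_product (univ.filter fun x : Fin (r+1) × Fin (r+1) =>
    x.1 ≠ 0 ∧ x.2 ∈ descendants p x.1 ∧ x.2 < x.1) _ _ (by simp)
    (f := fun x : Fin (r+1) × Fin (r+1) => e (p x.1) x.2)]
  refine sum_subset ?_ ?_
  · rintro ⟨i, j⟩ h
    obtain ⟨-, hi, -, -, hk, hji, -⟩ := mem_filter.1 h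
    exact mem_filter.2 ⟨mem_univ _, hi, mem_descendants.2 hk, hji⟩
  · rintro ⟨i, j⟩ h h'
    obtain ⟨-, hi, hk, hji⟩ := mem_filter.1 h
    obtain ⟨k, hk⟩ := mem_descendants.1 hk
    simp only at hi hk hji
    by_contra hne
    refine h' (mem_filter.2 ⟨mem_product.2 ⟨mem_univ _, mem_univ _⟩, hi, ?_, hji.ne', ⟨k, hk⟩, hji, ?_, ?_⟩)
    · rintro rfl
      rw [Function.iterate_fixed hp.2.1] at hk
      exact hi hk.symm
    · intro hpi
      obtain ⟨m, hm⟩ := hp.2.2.2 i (mem_univ i)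
      exact hi (eq_root_of_iterate_eq_self hp.2.1 hm (n := k)
        (by rw [Function.iterate_succ_apply, hpi, hk]))
    · rw [he]
      exact Nat.pos_of_ne_zero hne

theorem parentMaps_subset {r : ℕ} (e : Fin (r+1) → Fin (r+1) → ℕ) :
    parentMaps e ⊆ rootedTrees univ 0 := by
  intro p hp
  simp only [parentMaps, mem_filter, mem_univ, true_and] at hp
  exact mem_rootedTrees.2 ⟨fun x hx => absurd (mem_univ x) hx, hp.1, fun x _ => mem_univ _,
    fun x _ => hp.2.2 x⟩

theorem Iinv_eq_treeSum {r : ℕ} {A : Type*} [CommRing A] {e : Fin (r+1) → Fin (r+1) → ℕ}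
    (he : ∀ i j, e i j = e j i) (q : A) :
    Iinv e q = q ^ (∑ i, e i i) * treeSum (kappaWeight q e) univ 0 := by
  rw [Iinv, treeSum]
  congr 1
  rw [← sum_subset (parentMaps_subset e)]
  · refine sum_congr rfl fun p hp => ?_
    rw [kappaStat_eq_sum he (mem_rootedTrees.1 (parentMaps_subset e hp)), ← prod_pow_eq_pow_sum,
      ← prod_mul_distrib]
    rfl
  · intro p hp hp'
    rw [mem_rootedTrees] at hp
    simp only [parentMaps, mem_filter, mem_univ, true_and, not_and, not_forall] at hp'
    obtain ⟨w, hw, hpw⟩ : ∃ w, w ≠ 0 ∧ ¬(p w ≠ w ∧ 0 < e w (p w)) := by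
      by_contra! h
      obtain ⟨x, hx⟩ := hp' hp.2.1 fun w hw => h w hw
      exact hx (hp.2.2.2 x (mem_univ x))
    refine prod_eq_zero (mem_erase.2 ⟨hw, mem_univ w⟩) ?_
    have hne : p w ≠ w := by
      intro h
      obtain ⟨m, hm⟩ := hp.2.2.2 w (mem_univ w)
      exact hw (eq_root_of_iterate_eq_self hp.2.1 hm (n := 0) h)
    have h0 : e w (p w) = 0 := by
      by_contra h
      exact hpw ⟨hne, Nat.pos_of_ne_zero h⟩
    simp [kappaWeight, nq, h0]

/-- The cumulants of `B ↦ q ^ #E(B)` are given by the inversion polynomial of the multigraph. -/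
theorem jointCumulant_pow_eq_Iinv {r : ℕ} {A : Type*} [CommRing A] (q : A)
    (c : Fin (r+1) → Fin (r+1) → ℕ) :
    jointCumulant (fun B => q ^ (∑ i ∈ B, ∑ j ∈ B, c i j)) univ =
      (q - 1) ^ r * Iinv (symCount c) q := by
  rw [jointCumulant_pow_eq_treeSum q c univ 0 (mem_univ _), Iinv_eq_treeSum (symCount_comm c)]
  simp

section ZeroExtended

variable {ι : Type*} [DecidableEq ι]

/-- The functions with values in `{1, …, N}` on `X`, extended by zero. -/
def zfill (X : Finset ι) (N : ℕ) : Finset (ι → ℕ) :=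
  (X.pi fun _ => Finset.Icc 1 N).image fun g c => if h : c ∈ X then g c h else 0

theorem mem_zfill {X : Finset ι} {N : ℕ} {τ : ι → ℕ} :
    τ ∈ zfill X N ↔ (∀ c ∈ X, τ c ∈ Finset.Icc 1 N) ∧ ∀ c, c ∉ X → τ c = 0 := by
  simp only [zfill, mem_image, mem_pi]
  constructor
  · rintro ⟨g, hg, rfl⟩
    exact ⟨fun c hc => by simpa only [dif_pos hc] using hg c hc, fun c hc => dif_neg hc⟩
  · rintro ⟨h1, h2⟩
    refine ⟨fun c _ => τ c, h1, funext fun c => ?_⟩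
    by_cases hc : c ∈ X
    · exact dif_pos hc
    · rw [dif_neg hc, h2 c hc]

theorem zfill_empty (N : ℕ) : zfill (∅ : Finset ι) N = {0} := by
  ext τ
  simp [mem_zfill, funext_iff]

theorem sum_zfill_union {A : Type*} [CommRing A] {X Y : Finset ι} (hXY : Disjoint X Y) (N : ℕ)
    {F G : (ι → ℕ) → A} (hF : ∀ τ τ', (∀ c ∈ X, τ c = τ' c) → F τ = F τ')
    (hG : ∀ τ τ', (∀ c ∈ Y, τ c = τ' c) → G τ = G τ') :
    (∑ τ ∈ zfill X N, F τ) * ∑ τ ∈ zfill Y N, G τ = ∑ τ ∈ zfill (X ∪ Y) N, F τ * G τ := by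
  rw [sum_mul_sum, ← sum_product']
  refine sum_nbij' (fun x c => if c ∈ X then x.1 c else x.2 c)
    (fun τ => (fun c => if c ∈ X then τ c else 0, fun c => if c ∈ Y then τ c else 0))
    ?_ ?_ ?_ ?_ ?_
  · rintro ⟨τ, τ'⟩ h
    obtain ⟨h1, h2⟩ := mem_product.1 h
    rw [mem_zfill] at h1 h2 ⊢
    refine ⟨fun c hc => ?_, fun c hc => ?_⟩
    · by_cases hcX : c ∈ X
      · simpa only [if_pos hcX] using h1.1 c hcX
      · simpa only [if_neg hcX] using h2.1 c ((mem_union.1 hc).resolve_left hcX)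
    · simp only [mem_union, not_or] at hc
      simpa only [if_neg hc.1] using h2.2 c hc.2
  · intro τ h
    rw [mem_zfill] at h
    rw [mem_product, mem_zfill, mem_zfill]
    refine ⟨⟨fun c hc => ?_, fun c hc => if_neg hc⟩, fun c hc => ?_, fun c hc => if_neg hc⟩
    · simpa only [if_pos hc] using h.1 c (mem_union_left _ hc)
    · simpa only [if_pos hc] using h.1 c (mem_union_right _ hc)
  · rintro ⟨τ, τ'⟩ h
    obtain ⟨h1, h2⟩ := mem_product.1 h
    rw [mem_zfill] at h1 h2
    refine Prod.ext (funext fun c => ?_) (funext fun c => ?_)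
    · by_cases hcX : c ∈ X
      · simp [hcX]
      · simpa [hcX] using (h1.2 c hcX).symm
    · by_cases hcY : c ∈ Y
      · simp [hcY, disjoint_right.1 hXY hcY]
      · simpa [hcY] using (h2.2 c hcY).symm
  · intro τ h
    rw [mem_zfill] at h
    funext c
    by_cases hcX : c ∈ X
    · simp [hcX]
    · by_cases hcY : c ∈ Y
      · simp [hcX, hcY]
      · simp [hcX, hcY, h.2 c (by simp [hcX, hcY])]
  · rintro ⟨τ, τ'⟩ h
    congr 1
    · exact hF _ _ fun c hc => by simp [hc]
    · exact hG _ _ fun c hc => by simp [disjoint_right.1 hXY hc]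

theorem prod_sum_zfill {A β : Type*} [CommRing A] [DecidableEq β] (π : Finset β)
    {X : β → Finset ι} (N : ℕ) {g : β → (ι → ℕ) → A}
    (hX : ∀ b ∈ π, ∀ b' ∈ π, b ≠ b' → Disjoint (X b) (X b'))
    (hg : ∀ b ∈ π, ∀ τ τ', (∀ c ∈ X b, τ c = τ' c) → g b τ = g b τ') :
    ∏ b ∈ π, ∑ τ ∈ zfill (X b) N, g b τ = ∑ τ ∈ zfill (π.biUnion X) N, ∏ b ∈ π, g b τ := by
  induction π using Finset.induction_on with
  | empty => simp [zfill_empty]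
  | insert a s ha ih =>
    rw [prod_insert ha, ih (fun b hb b' hb' => hX b (mem_insert_of_mem hb) b'
      (mem_insert_of_mem hb')) fun b hb => hg b (mem_insert_of_mem hb), biUnion_insert,
      sum_zfill_union]
    · exact sum_congr rfl fun τ _ => by rw [prod_insert ha]
    · rw [disjoint_biUnion_right]
      exact fun b hb => hX a (mem_insert_self _ _) b (mem_insert_of_mem hb) fun h => ha (h ▸ hb)
    · exact hg a (mem_insert_self _ _)
    · exact fun τ τ' h => prod_congr rfl fun b hb => hg b (mem_insert_of_mem hb) τ τ' fun c hc =>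
        h c (mem_biUnion.2 ⟨b, hb, hc⟩)

end ZeroExtended

section Diagrams

variable {f : ℕ → ℕ}

theorem IsPartitionFun.le_nRows (hf : IsPartitionFun f) {j : ℕ} (hj : f j ≠ 0) :
    j ≤ nRows f := by
  obtain ⟨hanti, M, hM⟩ := hf
  refine le_csSup ⟨M, fun i hi => ?_⟩ hj
  by_contra! h
  exact hi (Nat.le_zero.1 (hM ▸ hanti h.le))

theorem IsPartitionFun.mem_cells (hf : IsPartitionFun f) {x j : ℕ} :
    (x, j) ∈ cells f ↔ 1 ≤ x ∧ 1 ≤ j ∧ x ≤ f j := by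
  simp only [cells, mem_filter, mem_product, Finset.mem_Icc]
  constructor
  · rintro ⟨⟨⟨h1, -⟩, h2, -⟩, h3⟩
    exact ⟨h1, h2, h3⟩
  · rintro ⟨h1, h2, h3⟩
    exact ⟨⟨⟨h1, h3.trans (hf.1 h2)⟩, h2, hf.le_nRows (by omega)⟩, h3⟩

theorem IsPartitionFun.le_colLen_iff (hf : IsPartitionFun f) {i j : ℕ} (hi : 1 ≤ i) (hj : 1 ≤ j) :
    j ≤ colLen f i ↔ i ≤ f j := by
  rw [colLen]
  constructor
  · intro h
    by_contra hij
    have hsub : ((Finset.Icc 1 (nRows f)).filter fun j => i ≤ f j) ⊆ Finset.Icc 1 (j - 1) := by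
      intro k hk
      obtain ⟨hk1, hk⟩ := mem_filter.1 hk
      rw [Finset.mem_Icc] at hk1 ⊢
      refine ⟨hk1.1, ?_⟩
      by_contra hjk
      exact hij (hk.trans (hf.1 (by omega)))
    have := card_le_card hsub
    rw [Nat.card_Icc] at this
    omega
  · intro h
    have hsub : Finset.Icc 1 j ⊆ (Finset.Icc 1 (nRows f)).filter fun j => i ≤ f j := by
      intro k hk
      rw [Finset.mem_Icc] at hk
      have hik : i ≤ f k := h.trans (hf.1 hk.2)
      rw [mem_filter, Finset.mem_Icc]
      exact ⟨⟨hk.1, hf.le_nRows (by omega)⟩, hik⟩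
    simpa using card_le_card hsub

theorem mem_fillings {N : ℕ} {σ : ℕ × ℕ → ℕ} :
    σ ∈ fillings f N ↔ (∀ c ∈ cells f, σ c ∈ Finset.Icc 1 N) ∧ ∀ c, c ∉ cells f → σ c = 0 := by
  rw [← mem_zfill]
  rfl

end Diagrams

section Coloring

variable {r : ℕ} {lam : Fin (r+1) → ℕ → ℕ}

theorem isPartitionFun_lamB (hlam : ∀ b, IsPartitionFun (lam b)) (B : Finset (Fin (r+1))) :
    IsPartitionFun (lamB lam B) := by
  refine ⟨fun i j hij => sum_le_sum fun b _ => (hlam b).1 hij, ?_⟩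
  choose M hM using fun b => (hlam b).2
  refine ⟨univ.sup M, sum_eq_zero fun b _ => Nat.le_zero.1 ?_⟩
  rw [← hM b]
  exact (hlam b).1 (le_sup (mem_univ b))

theorem mem_columnPairs {B : Finset (Fin (r+1))} {p : Fin (r+1) × ℕ} :
    p ∈ columnPairs lam B ↔ p.1 ∈ B ∧ 1 ≤ p.2 ∧ p.2 ≤ lam p.1 1 := by
  simp only [columnPairs, mem_filter, mem_product, Finset.mem_Icc]
  constructor
  · rintro ⟨⟨h1, h2, -⟩, h3⟩
    exact ⟨h1, h2, h3⟩
  · rintro ⟨h1, h2, h3⟩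
    exact ⟨⟨h1, h2, h3.trans (single_le_sum (f := fun b => lam b 1) (fun _ _ => Nat.zero_le _) h1)⟩,
      h3⟩

theorem colBefore_refl (p : Fin (r+1) × ℕ) : colBefore lam p p := by
  simp [colBefore]

theorem colBefore.trans {p₁ p₂ p₃ : Fin (r+1) × ℕ} (h : colBefore lam p₁ p₂)
    (h' : colBefore lam p₂ p₃) : colBefore lam p₁ p₃ := by
  simp only [colBefore, Fin.lt_def, Fin.ext_iff] at *
  omega

theorem colBefore_total (p₁ p₂ : Fin (r+1) × ℕ) : colBefore lam p₁ p₂ ∨ colBefore lam p₂ p₁ := by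
  simp only [colBefore, Fin.lt_def, Fin.ext_iff]
  omega

theorem colBefore.antisymm {p₁ p₂ : Fin (r+1) × ℕ} (h : colBefore lam p₁ p₂)
    (h' : colBefore lam p₂ p₁) : p₁ = p₂ := by
  simp only [colBefore, Fin.lt_def, Prod.ext_iff, Fin.ext_iff] at *
  omega

theorem colBefore.colLen_le {p₁ p₂ : Fin (r+1) × ℕ} (h : colBefore lam p₁ p₂) :
    colLen (lam p₂.1) p₂.2 ≤ colLen (lam p₁.1) p₁.2 := by
  simp only [colBefore] at h
  omega

variable {B : Finset (Fin (r+1))}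

theorem posIn_lt_of_colBefore {p p' : Fin (r+1) × ℕ} (hp' : p' ∈ columnPairs lam B)
    (h : colBefore lam p p') (hne : p ≠ p') : posIn lam B p.1 p.2 < posIn lam B p'.1 p'.2 := by
  refine card_lt_card (ssubset_iff_of_subset ?_ |>.2 ⟨p', ?_, ?_⟩)
  · intro x hx
    rw [mem_filter] at hx ⊢
    exact ⟨hx.1, hx.2.trans h⟩
  · exact mem_filter.2 ⟨hp', colBefore_refl p'⟩
  · exact fun hx => hne (h.antisymm (mem_filter.1 hx).2)

theorem posIn_lt_iff {p p' : Fin (r+1) × ℕ} (hp : p ∈ columnPairs lam B)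
    (hp' : p' ∈ columnPairs lam B) :
    posIn lam B p.1 p.2 < posIn lam B p'.1 p'.2 ↔ colBefore lam p p' ∧ p ≠ p' := by
  constructor
  · intro h
    have hne : p ≠ p' := by
      rintro rfl
      exact lt_irrefl _ h
    refine ⟨(colBefore_total p p').resolve_right fun h' => ?_, hne⟩
    exact lt_asymm h (posIn_lt_of_colBefore hp h' hne.symm)
  · exact fun h => posIn_lt_of_colBefore hp' h.1 h.2

theorem posIn_injOn {p p' : Fin (r+1) × ℕ} (hp : p ∈ columnPairs lam B)
    (hp' : p' ∈ columnPairs lam B) (h : posIn lam B p.1 p.2 = posIn lam B p'.1 p'.2) : p = p' := by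
  by_contra hne
  rcases colBefore_total (lam := lam) p p' with h' | h'
  · exact h.not_lt (posIn_lt_of_colBefore hp' h' hne)
  · exact h.not_gt (posIn_lt_of_colBefore hp h' (Ne.symm hne))

theorem colAt_posIn {p : Fin (r+1) × ℕ} (hp : p ∈ columnPairs lam B) :
    colAt lam B (posIn lam B p.1 p.2) = p := by
  have h : ∃ p' ∈ columnPairs lam B, posIn lam B p'.1 p'.2 = posIn lam B p.1 p.2 := ⟨p, hp, rfl⟩
  rw [colAt, dif_pos h]
  exact posIn_injOn h.choose_spec.1 hp h.choose_spec.2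

theorem card_filter_columnPairs (hlam : ∀ b, IsPartitionFun (lam b)) {j : ℕ} (hj : 1 ≤ j) :
    ((columnPairs lam B).filter fun p => j ≤ colLen (lam p.1) p.2).card = lamB lam B j := by
  rw [card_eq_sum_card_fiberwise (f := Prod.fst) (t := B)
    fun p hp => (mem_columnPairs.1 (mem_filter.1 hp).1).1, lamB]
  refine sum_congr rfl fun b hb => ?_
  have : (((columnPairs lam B).filter fun p => j ≤ colLen (lam p.1) p.2).filter
      fun p => p.1 = b) = (Finset.Icc 1 (lam b j)).image (Prod.mk b) := by
    ext ⟨b', i⟩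
    simp only [mem_filter, mem_columnPairs, mem_image, Finset.mem_Icc, Prod.mk.injEq]
    constructor
    · rintro ⟨⟨⟨-, h1, -⟩, h2⟩, rfl⟩
      exact ⟨i, ⟨h1, ((hlam b').le_colLen_iff h1 hj).1 h2⟩, rfl, rfl⟩
    · rintro ⟨i', ⟨h1, h2⟩, rfl, rfl⟩
      exact ⟨⟨⟨hb, h1, h2.trans ((hlam b).1 hj)⟩, ((hlam b).le_colLen_iff h1 hj).2 h2⟩, rfl⟩
  rw [this, card_image_of_injective _ (Prod.mk_right_injective b), Nat.card_Icc,
    Nat.add_sub_cancel]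

theorem one_le_posIn {p : Fin (r+1) × ℕ} (hp : p ∈ columnPairs lam B) :
    1 ≤ posIn lam B p.1 p.2 :=
  card_pos.2 ⟨p, mem_filter.2 ⟨hp, colBefore_refl p⟩⟩

theorem posIn_le_lamB_iff (hlam : ∀ b, IsPartitionFun (lam b)) {p : Fin (r+1) × ℕ}
    (hp : p ∈ columnPairs lam B) {j : ℕ} (hj : 1 ≤ j) :
    posIn lam B p.1 p.2 ≤ lamB lam B j ↔ j ≤ colLen (lam p.1) p.2 := by
  rw [← card_filter_columnPairs hlam hj]
  constructor
  · intro h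
    by_contra hlt
    refine h.not_gt (card_lt_card (ssubset_iff_of_subset ?_ |>.2 ⟨p, ?_, ?_⟩))
    · intro x hx
      obtain ⟨hx, hjx⟩ := mem_filter.1 hx
      refine mem_filter.2 ⟨hx, (colBefore_total x p).resolve_right fun h' => ?_⟩
      exact hlt (hjx.trans h'.colLen_le)
    · exact mem_filter.2 ⟨hp, colBefore_refl p⟩
    · exact fun h => hlt (mem_filter.1 h).2
  · intro h
    refine card_le_card fun x hx => ?_
    obtain ⟨hx, hxp⟩ := mem_filter.1 hx
    exact mem_filter.2 ⟨hx, h.trans hxp.colLen_le⟩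

theorem colLen_lamB_posIn (hlam : ∀ b, IsPartitionFun (lam b)) {p : Fin (r+1) × ℕ}
    (hp : p ∈ columnPairs lam B) :
    colLen (lamB lam B) (posIn lam B p.1 p.2) = colLen (lam p.1) p.2 := by
  refine eq_of_forall_le_iff fun j => ?_
  rcases Nat.eq_zero_or_pos j with rfl | hj
  · simp
  · rw [(isPartitionFun_lamB hlam B).le_colLen_iff (one_le_posIn hp) hj,
      posIn_le_lamB_iff hlam hp hj]

theorem exists_posIn_eq (hlam : ∀ b, IsPartitionFun (lam b)) {x : ℕ} (hx : 1 ≤ x)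
    (hx' : x ≤ lamB lam B 1) : ∃ p ∈ columnPairs lam B, posIn lam B p.1 p.2 = x := by
  have hlen : ∀ p ∈ columnPairs lam B, 1 ≤ colLen (lam p.1) p.2 := fun p hp => by
    obtain ⟨-, h1, h2⟩ := mem_columnPairs.1 hp
    exact ((hlam p.1).le_colLen_iff h1 le_rfl).2 h2
  have himg : (columnPairs lam B).image (fun p => posIn lam B p.1 p.2) =
      Finset.Icc 1 (lamB lam B 1) := by
    refine eq_of_subset_of_card_le ?_ ?_
    · intro y hy
      obtain ⟨p, hp, rfl⟩ := mem_image.1 hy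
      exact Finset.mem_Icc.2 ⟨one_le_posIn hp, (posIn_le_lamB_iff hlam hp le_rfl).2 (hlen p hp)⟩
    · rw [card_image_of_injOn fun p hp p' hp' => posIn_injOn hp hp', Nat.card_Icc,
        Nat.add_sub_cancel, ← card_filter_columnPairs hlam le_rfl, filter_true_of_mem hlen]
  simpa only [mem_image] using himg.ge (Finset.mem_Icc.2 ⟨hx, hx'⟩)

end Coloring

section LabelledFillings

variable {r : ℕ} (lam : Fin (r+1) → ℕ → ℕ) (B : Finset (Fin (r+1)))

/-- The boxes of the diagrams `λ^b`, `b ∈ B`: a label of a column together with a row index. -/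
def labelledCells : Finset ((Fin (r+1) × ℕ) × ℕ) :=
  (columnPairs lam B).biUnion fun p => (Finset.Icc 1 (colLen (lam p.1) p.2)).image (Prod.mk p)

/-- The box of `λ^B` corresponding to a labelled box. -/
def cellPos (c : (Fin (r+1) × ℕ) × ℕ) : ℕ × ℕ := (posIn lam B c.1.1 c.1.2, c.2)

/-- The filling of `λ^B` corresponding to a filling of the labelled boxes. -/
def unlabel (τ : (Fin (r+1) × ℕ) × ℕ → ℕ) (c : ℕ × ℕ) : ℕ :=
  if c ∈ cells (lamB lam B) then τ (colAt lam B c.1, c.2) else 0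

/-- The entry below a box, read as `0` in the first row. -/
def entryBelow {P : Type*} (τ : P × ℕ → ℕ) (c : P × ℕ) : ℕ :=
  if 2 ≤ c.2 then τ (c.1, c.2 - 1) else 0

/-- The inversion pairs of a filling of the labelled boxes. -/
def labelledInvPairs (τ : (Fin (r+1) × ℕ) × ℕ → ℕ) :
    Finset (((Fin (r+1) × ℕ) × ℕ) × ((Fin (r+1) × ℕ) × ℕ)) :=
  (labelledCells lam B ×ˢ labelledCells lam B).filter fun x =>
    x.1.2 = x.2.2 ∧ (colBefore lam x.1.1 x.2.1 ∧ x.1.1 ≠ x.2.1) ∧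
      ((τ x.1 ≤ entryBelow τ x.1 ∧ entryBelow τ x.1 < τ x.2) ∨
        (entryBelow τ x.1 < τ x.2 ∧ τ x.2 < τ x.1) ∨ (τ x.2 < τ x.1 ∧ τ x.1 ≤ entryBelow τ x.1))

/-- The contribution of a labelled box to `t ^ maj(τ) * x ^ τ`. -/
def cellWeight (τ : (Fin (r+1) × ℕ) × ℕ → ℕ) (c : (Fin (r+1) × ℕ) × ℕ) : MR :=
  tv ^ (if 2 ≤ c.2 ∧ entryBelow τ c < τ c then colLen (lam c.1.1) c.1.2 - c.2 + 1 else 0) * xv (τ c)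

variable {lam B}

theorem mem_labelledCells {c : (Fin (r+1) × ℕ) × ℕ} :
    c ∈ labelledCells lam B ↔
      c.1 ∈ columnPairs lam B ∧ 1 ≤ c.2 ∧ c.2 ≤ colLen (lam c.1.1) c.1.2 := by
  obtain ⟨p, j⟩ := c
  simp only [labelledCells, mem_biUnion, mem_image, Finset.mem_Icc, Prod.mk.injEq]
  constructor
  · rintro ⟨p', hp, j', h, rfl, rfl⟩
    exact ⟨hp, h⟩
  · rintro ⟨hp, h⟩
    exact ⟨p, hp, j, h, rfl, rfl⟩

theorem mem_labelledCells_iff_univ {c : (Fin (r+1) × ℕ) × ℕ} :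
    c ∈ labelledCells lam B ↔ c ∈ labelledCells lam univ ∧ c.1.1 ∈ B := by
  simp only [mem_labelledCells, mem_columnPairs, mem_univ]
  tauto

theorem cellPos_injOn : Set.InjOn (cellPos lam B) (labelledCells lam B) := by
  rintro ⟨p, j⟩ hc ⟨p', j'⟩ hc' h
  rw [mem_coe, mem_labelledCells] at hc hc'
  simp only [cellPos, Prod.mk.injEq] at h
  exact Prod.ext (posIn_injOn hc.1 hc'.1 h.1) h.2

theorem cellPos_mem_cells (hlam : ∀ b, IsPartitionFun (lam b)) {c : (Fin (r+1) × ℕ) × ℕ}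
    (hc : c.1 ∈ columnPairs lam B) :
    cellPos lam B c ∈ cells (lamB lam B) ↔ c ∈ labelledCells lam B := by
  rw [cellPos, (isPartitionFun_lamB hlam B).mem_cells, mem_labelledCells]
  constructor
  · rintro ⟨-, h1, h2⟩
    exact ⟨hc, h1, (posIn_le_lamB_iff hlam hc h1).1 h2⟩
  · rintro ⟨-, h1, h2⟩
    exact ⟨one_le_posIn hc, h1, (posIn_le_lamB_iff hlam hc h1).2 h2⟩

theorem cells_lamB (hlam : ∀ b, IsPartitionFun (lam b)) :
    cells (lamB lam B) = (labelledCells lam B).image (cellPos lam B) := by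
  ext ⟨x, j⟩
  rw [mem_image]
  constructor
  · intro h
    have hp := isPartitionFun_lamB hlam B
    obtain ⟨h1, h2, h3⟩ := hp.mem_cells.1 h
    obtain ⟨p, hpB, rfl⟩ := exists_posIn_eq hlam h1 (h3.trans (hp.1 h2))
    exact ⟨(p, j), (cellPos_mem_cells hlam hpB).1 h, rfl⟩
  · rintro ⟨c, hc, hcx⟩
    rw [← hcx]
    exact (cellPos_mem_cells hlam (mem_labelledCells.1 hc).1).2 hc

theorem unlabel_cellPos (hlam : ∀ b, IsPartitionFun (lam b)) {N : ℕ}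
    {τ : (Fin (r+1) × ℕ) × ℕ → ℕ} (hτ : τ ∈ zfill (labelledCells lam B) N)
    {c : (Fin (r+1) × ℕ) × ℕ} (hc : c.1 ∈ columnPairs lam B) :
    unlabel lam B τ (cellPos lam B c) = τ c := by
  by_cases h : c ∈ labelledCells lam B
  · rw [unlabel, if_pos ((cellPos_mem_cells hlam hc).2 h)]
    simp only [cellPos, colAt_posIn hc]
  · rw [unlabel, if_neg fun h' => h ((cellPos_mem_cells hlam hc).1 h'), (mem_zfill.1 hτ).2 c h]

theorem unlabel_below (hlam : ∀ b, IsPartitionFun (lam b)) {N : ℕ}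
    {τ : (Fin (r+1) × ℕ) × ℕ → ℕ} (hτ : τ ∈ zfill (labelledCells lam B) N)
    {c : (Fin (r+1) × ℕ) × ℕ} (hc : c ∈ labelledCells lam B) :
    unlabel lam B τ (posIn lam B c.1.1 c.1.2, c.2 - 1) = entryBelow τ c := by
  have h := unlabel_cellPos hlam hτ (c := (c.1, c.2 - 1)) (mem_labelledCells.1 hc).1
  rw [cellPos] at h
  rw [h, entryBelow]
  by_cases h2 : 2 ≤ c.2
  · rw [if_pos h2]
  · rw [if_neg h2]
    refine (mem_zfill.1 hτ).2 _ fun h' => ?_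
    have := (mem_labelledCells.1 h').2.1
    simp only at this
    omega

theorem sum_fillings_lamB (hlam : ∀ b, IsPartitionFun (lam b)) (N : ℕ) {A : Type*}
    [AddCommMonoid A] (F : (ℕ × ℕ → ℕ) → A) :
    ∑ σ ∈ fillings (lamB lam B) N, F σ =
      ∑ τ ∈ zfill (labelledCells lam B) N, F (unlabel lam B τ) := by
  symm
  refine sum_nbij' (fun τ => unlabel lam B τ)
    (fun σ c => if c ∈ labelledCells lam B then σ (cellPos lam B c) else 0) ?_ ?_ ?_ ?_ ?_
  · intro τ hτ
    rw [mem_fillings]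
    refine ⟨fun c hc => ?_, fun c hc => if_neg hc⟩
    rw [cells_lamB hlam, mem_image] at hc
    obtain ⟨c, hc, rfl⟩ := hc
    rw [unlabel_cellPos hlam hτ (mem_labelledCells.1 hc).1]
    exact (mem_zfill.1 hτ).1 c hc
  · intro σ hσ
    rw [mem_fillings] at hσ
    rw [mem_zfill]
    refine ⟨fun c hc => ?_, fun c hc => if_neg hc⟩
    simp only [if_pos hc]
    exact hσ.1 _ ((cellPos_mem_cells hlam (mem_labelledCells.1 hc).1).2 hc)
  · intro τ hτ
    funext c
    by_cases hc : c ∈ labelledCells lam B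
    · simp only [if_pos hc, unlabel_cellPos hlam hτ (mem_labelledCells.1 hc).1]
    · simp only [if_neg hc, (mem_zfill.1 hτ).2 c hc]
  · intro σ hσ
    rw [mem_fillings] at hσ
    funext c
    by_cases hc : c ∈ cells (lamB lam B)
    · rw [unlabel, if_pos hc]
      rw [cells_lamB hlam, mem_image] at hc
      obtain ⟨c, hc, rfl⟩ := hc
      have : (colAt lam B (cellPos lam B c).1, (cellPos lam B c).2) = c := by
        simp only [cellPos, colAt_posIn (mem_labelledCells.1 hc).1]
      rw [this, if_pos hc]
    · rw [unlabel, if_neg hc, hσ.2 c hc]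
  · exact fun _ _ => rfl

theorem invPairs_unlabel (hlam : ∀ b, IsPartitionFun (lam b)) {N : ℕ}
    {τ : (Fin (r+1) × ℕ) × ℕ → ℕ} (hτ : τ ∈ zfill (labelledCells lam B) N) :
    invPairs (lamB lam B) (unlabel lam B τ) =
      (labelledInvPairs lam B τ).image (Prod.map (cellPos lam B) (cellPos lam B)) := by
  have key : ∀ c ∈ labelledCells lam B, ∀ c' ∈ labelledCells lam B,
      ((cellPos lam B c).2 = (cellPos lam B c').2 ∧ (cellPos lam B c).1 < (cellPos lam B c').1 ∧
        invTriple (unlabel lam B τ) (cellPos lam B c) (cellPos lam B c')) ↔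
      (c, c') ∈ labelledInvPairs lam B τ := by
    intro c hc c' hc'
    have hp := (mem_labelledCells.1 hc).1
    have hp' := (mem_labelledCells.1 hc').1
    rw [labelledInvPairs, mem_filter, invTriple, unlabel_cellPos hlam hτ hp,
      unlabel_cellPos hlam hτ hp']
    simp only [cellPos, unlabel_below hlam hτ hc, posIn_lt_iff hp hp', mem_product, hc, hc',
      and_self, true_and]
  ext ⟨y, y'⟩
  rw [invPairs, mem_filter, mem_product, mem_image]
  constructor
  · rintro ⟨⟨hy, hy'⟩, h⟩
    simp only at hy hy' h
    rw [cells_lamB hlam, mem_image] at hy hy'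
    obtain ⟨c, hc, rfl⟩ := hy
    obtain ⟨c', hc', rfl⟩ := hy'
    exact ⟨(c, c'), (key c hc c' hc').1 h, rfl⟩
  · rintro ⟨⟨c, c'⟩, h, heq⟩
    obtain ⟨hc, hc'⟩ := mem_product.1 (mem_filter.1 h).1
    rw [← heq]
    exact ⟨⟨(cellPos_mem_cells hlam (mem_labelledCells.1 hc).1).2 hc,
      (cellPos_mem_cells hlam (mem_labelledCells.1 hc').1).2 hc'⟩, (key c hc c' hc').2 h⟩

theorem map_cellPos_injOn (τ : (Fin (r+1) × ℕ) × ℕ → ℕ) :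
    Set.InjOn (Prod.map (cellPos lam B) (cellPos lam B)) (labelledInvPairs lam B τ) := by
  rintro ⟨c₁, c₂⟩ h ⟨c₁', c₂'⟩ h' heq
  obtain ⟨h₁, h₂⟩ := mem_product.1 (mem_filter.1 h).1
  obtain ⟨h₁', h₂'⟩ := mem_product.1 (mem_filter.1 h').1
  obtain ⟨e₁, e₂⟩ := Prod.ext_iff.1 heq
  exact Prod.ext (cellPos_injOn h₁ h₁' e₁) (cellPos_injOn h₂ h₂' e₂)

theorem pow_majStat_mul_prod (hlam : ∀ b, IsPartitionFun (lam b)) {N : ℕ}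
    {τ : (Fin (r+1) × ℕ) × ℕ → ℕ} (hτ : τ ∈ zfill (labelledCells lam B) N) :
    tv ^ majStat (lamB lam B) (unlabel lam B τ) *
        ∏ c ∈ cells (lamB lam B), xv (unlabel lam B τ c) =
      ∏ c ∈ labelledCells lam B, cellWeight lam τ c := by
  rw [majStat, desSet, sum_filter, cells_lamB hlam, sum_image cellPos_injOn,
    prod_image cellPos_injOn, ← prod_pow_eq_pow_sum, ← prod_mul_distrib]
  refine prod_congr rfl fun c hc => ?_
  have hp := (mem_labelledCells.1 hc).1
  rw [unlabel_cellPos hlam hτ hp]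
  simp only [cellPos, unlabel_below hlam hτ hc, colLen_lamB_posIn hlam hp, cellWeight]

theorem macH_lamB (hlam : ∀ b, IsPartitionFun (lam b)) (N : ℕ) :
    macH (lamB lam B) N = ∑ τ ∈ zfill (labelledCells lam B) N,
      qv ^ (labelledInvPairs lam B τ).card * ∏ c ∈ labelledCells lam B, cellWeight lam τ c := by
  rw [macH, sum_fillings_lamB hlam]
  refine sum_congr rfl fun τ hτ => ?_
  rw [mul_assoc, pow_majStat_mul_prod hlam hτ, invStat, invPairs_unlabel hlam hτ,
    card_image_of_injOn (map_cellPos_injOn τ)]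

theorem entryBelow_congr {τ τ' : (Fin (r+1) × ℕ) × ℕ → ℕ}
    (h : ∀ c ∈ labelledCells lam B, τ c = τ' c) {c : (Fin (r+1) × ℕ) × ℕ}
    (hc : c ∈ labelledCells lam B) : entryBelow τ c = entryBelow τ' c := by
  rw [entryBelow, entryBelow]
  by_cases h2 : 2 ≤ c.2
  · rw [if_pos h2, if_pos h2]
    rw [mem_labelledCells] at hc
    exact h _ (mem_labelledCells.2 ⟨hc.1, by simp only; omega, by simp only; omega⟩)
  · rw [if_neg h2, if_neg h2]

theorem labelledInvPairs_congr {τ τ' : (Fin (r+1) × ℕ) × ℕ → ℕ}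
    (h : ∀ c ∈ labelledCells lam B, τ c = τ' c) :
    labelledInvPairs lam B τ = labelledInvPairs lam B τ' := by
  refine filter_congr fun x hx => ?_
  obtain ⟨h₁, h₂⟩ := mem_product.1 hx
  rw [h _ h₁, h _ h₂, entryBelow_congr h h₁]

theorem cellWeight_congr {τ τ' : (Fin (r+1) × ℕ) × ℕ → ℕ}
    (h : ∀ c ∈ labelledCells lam B, τ c = τ' c) {c : (Fin (r+1) × ℕ) × ℕ}
    (hc : c ∈ labelledCells lam B) : cellWeight lam τ c = cellWeight lam τ' c := by
  rw [cellWeight, cellWeight, h _ hc, entryBelow_congr h hc]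

variable (lam) in
/-- The number of inversion pairs whose left box has color `i` and right box has color `j`. -/
def orderedInvCount (τ : (Fin (r+1) × ℕ) × ℕ → ℕ) (i j : Fin (r+1)) : ℕ :=
  ((labelledInvPairs lam univ τ).filter fun x => x.1.1.1 = i ∧ x.2.1.1 = j).card

theorem card_labelledInvPairs (τ : (Fin (r+1) × ℕ) × ℕ → ℕ) :
    (labelledInvPairs lam B τ).card = ∑ i ∈ B, ∑ j ∈ B, orderedInvCount lam τ i j := by
  have hB : ∀ x, x ∈ labelledInvPairs lam B τ ↔
      x ∈ labelledInvPairs lam univ τ ∧ x.1.1.1 ∈ B ∧ x.2.1.1 ∈ B := by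
    intro x
    rw [labelledInvPairs, labelledInvPairs, mem_filter, mem_filter, mem_product, mem_product,
      mem_labelledCells_iff_univ (B := B), mem_labelledCells_iff_univ (B := B)]
    tauto
  rw [← sum_product', card_eq_sum_card_fiberwise (f := fun x => (x.1.1.1, x.2.1.1)) (t := B ×ˢ B)
    fun x hx => mem_product.2 ((hB x).1 hx).2]
  refine sum_congr rfl fun y hy => ?_
  obtain ⟨h₁, h₂⟩ := mem_product.1 hy
  rw [orderedInvCount]
  congr 1
  ext x
  rw [mem_filter, mem_filter, hB, Prod.ext_iff]
  constructor
  · rintro ⟨⟨hx, -⟩, h⟩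
    exact ⟨hx, h⟩
  · rintro ⟨hx, h⟩
    exact ⟨⟨hx, h.1.symm ▸ h₁, h.2.symm ▸ h₂⟩, h⟩

theorem eG_unlabel (hlam : ∀ b, IsPartitionFun (lam b)) {N : ℕ}
    {τ : (Fin (r+1) × ℕ) × ℕ → ℕ} (hτ : τ ∈ zfill (labelledCells lam univ) N) :
    eG lam (unlabel lam univ τ) = symCount (orderedInvCount lam τ) := by
  funext i j
  have hcol : ∀ c ∈ labelledCells lam univ, colColor lam (cellPos lam univ c).1 = c.1.1 :=
    fun c hc => by rw [colColor, cellPos, colAt_posIn (mem_labelledCells.1 hc).1]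
  have hcard : eG lam (unlabel lam univ τ) i j = ((labelledInvPairs lam univ τ).filter fun x =>
      (x.1.1.1 = i ∧ x.2.1.1 = j) ∨ (x.1.1.1 = j ∧ x.2.1.1 = i)).card := by
    rw [eG, invPairs_unlabel hlam hτ, filter_image,
      card_image_of_injOn ((map_cellPos_injOn τ).mono (coe_subset.2 (filter_subset _ _)))]
    congr 1
    refine filter_congr fun x hx => ?_
    obtain ⟨h₁, h₂⟩ := mem_product.1 (mem_filter.1 hx).1
    simp only [Prod.map_fst, Prod.map_snd, hcol _ h₁, hcol _ h₂]
  rw [hcard, symCount]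
  by_cases hij : i = j
  · subst hij
    simp only [or_self, if_true, orderedInvCount]
  · rw [if_neg hij, filter_or, card_union_of_disjoint, orderedInvCount, orderedInvCount]
    refine disjoint_filter.2 fun x _ h h' => hij (h.1.symm.trans h'.1)

theorem disjoint_labelledCells {B' : Finset (Fin (r+1))} (h : Disjoint B B') :
    Disjoint (labelledCells lam B) (labelledCells lam B') :=
  disjoint_left.2 fun _ hc hc' => disjoint_left.1 h (mem_labelledCells_iff_univ.1 hc).2
    (mem_labelledCells_iff_univ.1 hc').2

theorem biUnion_labelledCells {π : Finset (Finset (Fin (r+1)))} (hπ : IsSetPartition π univ) :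
    π.biUnion (labelledCells lam) = labelledCells lam univ := by
  ext c
  rw [mem_biUnion]
  constructor
  · rintro ⟨B, -, hc⟩
    exact (mem_labelledCells_iff_univ.1 hc).1
  · intro hc
    obtain ⟨B, hB, hcB⟩ := hπ.2.2.2 c.1.1 (mem_univ _)
    exact ⟨B, hB, mem_labelledCells_iff_univ.2 ⟨hc, hcB⟩⟩

theorem prod_macH_lamB (hlam : ∀ b, IsPartitionFun (lam b)) (N : ℕ)
    {π : Finset (Finset (Fin (r+1)))} (hπ : IsSetPartition π univ) :
    ∏ B ∈ π, macH (lamB lam B) N = ∑ τ ∈ zfill (labelledCells lam univ) N,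
      (∏ B ∈ π, qv ^ (∑ i ∈ B, ∑ j ∈ B, orderedInvCount lam τ i j)) *
        ∏ c ∈ labelledCells lam univ, cellWeight lam τ c := by
  have hdisj : ∀ B ∈ π, ∀ B' ∈ π, B ≠ B' → Disjoint (labelledCells lam B) (labelledCells lam B') :=
    fun B hB B' hB' hne => disjoint_labelledCells (hπ.2.2.1 B hB B' hB' hne)
  simp only [macH_lamB hlam]
  rw [prod_sum_zfill π N hdisj, biUnion_labelledCells hπ]
  · refine sum_congr rfl fun τ _ => ?_
    rw [prod_mul_distrib, ← biUnion_labelledCells hπ, prod_biUnion fun B hB B' hB' =>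
      hdisj B hB B' hB']
    simp only [card_labelledInvPairs]
  · intro B _ τ τ' h
    rw [labelledInvPairs_congr h]
    exact congrArg _ (prod_congr rfl fun c hc => cellWeight_congr h hc)

end LabelledFillings

/-- **Theorem 1.6 (main result), in `N` variables.** For partitions `λ^0, …, λ^r`,
`Σ_{π ∈ 𝒫([r])} (-1)^{#π-1}(#π-1)! Π_{B∈π} H̃_{λ^B}
  = (q-1)^{#[r]-1} Σ_{σ : λ^{[r]} → {1,…,N}} 𝓘_{G^σ}(q) t^{maj(σ)} x^σ`. -/
theorem stmt7 (r N : ℕ) (hN : 1 ≤ N) (lam : Fin (r+1) → ℕ → ℕ)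
    (hlam : ∀ b, IsPartitionFun (lam b)) :
    macCumulant lam N =
      (qv - 1) ^ r *
        ∑ σ ∈ fillings (lamB lam univ) N,
          Iinv (eG lam σ) qv * tv ^ majStat (lamB lam univ) σ *
            ∏ c ∈ cells (lamB lam univ), xv (σ c) := by
  have hL : macCumulant lam N = ∑ τ ∈ zfill (labelledCells lam univ) N,
      jointCumulant (fun B => qv ^ (∑ i ∈ B, ∑ j ∈ B, orderedInvCount lam τ i j)) univ *
        ∏ c ∈ labelledCells lam univ, cellWeight lam τ c := by
    simp only [macCumulant, jointCumulant, sum_mul]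
    rw [sum_comm]
    refine sum_congr rfl fun π hπ => ?_
    rw [prod_macH_lamB hlam N (mem_setPartitions.1 hπ), mul_sum]
    exact sum_congr rfl fun τ _ => (mul_assoc _ _ _).symm
  rw [hL, sum_fillings_lamB hlam, mul_sum]
  refine sum_congr rfl fun τ hτ => ?_
  rw [jointCumulant_pow_eq_Iinv, eG_unlabel hlam hτ, mul_assoc (Iinv _ _),
    pow_majStat_mul_prod hlam hτ, mul_assoc]

end
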